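/- arXiv:2602.06073 — 3 statements merged into one kernel-verified Lean document; each statement's English description precedes it below -/
import Mathlib

section
/- Let D be an odd positive integer with D ≠ 7. Then the equation z² + D = 2ⁿ has at most two solutions in positive integers (z, n). -/
open Polynomial

/-- factorial divides a power of p in the p-adic integers. -/
lemma ap_fact_dvd (p : ℕ) [hp : Fact p.Prime] (n e : ℕ) (h : padicValNat p n.factorial ≤ e) :
    ((n.factorial : ℕ) : ℤ_[p]) ∣ (p : ℤ_[p]) ^ e := by
  obtain ⟨c, hc⟩ := (pow_padicValNat_dvd : p ^ padicValNat p n.factorial ∣ n.factorial)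
  have hc0 : ¬ p ∣ c := by
    intro hd
    have : p ^ (padicValNat p n.factorial + 1) ∣ n.factorial := by
      obtain ⟨d, rfl⟩ := hd
      exact ⟨d, by rw [pow_succ, mul_assoc]; exact hc⟩
    exact pow_succ_padicValNat_not_dvd (Nat.factorial_ne_zero n) this
  have hu : IsUnit ((c : ℕ) : ℤ_[p]) := by
    rw [PadicInt.isUnit_iff]
    have := (PadicInt.norm_int_lt_one_iff_dvd (p := p) (c : ℤ)).not
    have h2 : ¬ ‖((c : ℤ) : ℤ_[p])‖ < 1 := by
      rw [this]; exact_mod_cast hc0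
    have h3 := PadicInt.norm_le_one (p := p) (c : ℤ_[p])
    push_cast at h2
    exact le_antisymm h3 (not_lt.mp h2)
  have : ((n.factorial : ℕ) : ℤ_[p]) = (p : ℤ_[p]) ^ padicValNat p n.factorial * c := by
    conv_lhs => rw [hc]
    push_cast; rfl
  rw [this, hu.mul_right_dvd]
  exact pow_dvd_pow _ h

lemma ap_val (p : ℕ) [hp : Fact p.Prime] (hp2 : p ≠ 2) (n : ℕ) (hn : n ≠ 0) :
    2 * padicValNat p n.factorial + 1 ≤ n := by
  have h := sub_one_mul_padicValNat_factorial (p := p) n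
  have h1 : 0 < (p.digits n).sum := by
    by_contra h0
    have h0 : (p.digits n).sum = 0 := by omega
    have hm : n ≡ (p.digits n).sum [MOD (p-1)] := Nat.modEq_digits_sum _ _ (by
      have := hp.out.two_le
      have h3 : p = (p - 1) + 1 := by omega
      rw [h3]
      by_cases h4 : p - 1 = 1
      · omega
      · simp [Nat.mod_eq_of_lt (show 1 < p - 1 by omega)]) n
    have hl := List.sum_eq_zero_iff.mp h0
    have hne := Nat.digits_ne_nil_iff_ne_zero (b := p).mpr hn
    exact Nat.getLast_digit_ne_zero p hn (hl _ (List.getLast_mem hne))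
  have h2 := hp.out.two_le
  have h3 : 2 * padicValNat p n.factorial ≤ (p - 1) * padicValNat p n.factorial :=
    Nat.mul_le_mul_right _ (by omega)
  omega

/-- polynomials with `(2(l+1))! C(m+l+1, 2(l+1)) = m (m+1) r_l(m)` -/
noncomputable def apR (R : Type*) [CommRing R] : ℕ → R[X]
  | 0 => 1
  | (l+1) => apR R l * ((X + C (l + 2 : R)) * (X - C (l + 1 : R)))

lemma apR_spec (R : Type*) [CommRing R] (l m : ℕ) :
    (((m + (l + 1)).choose (2 * (l + 1)) * (2 * (l + 1)).factorial : ℕ) : R)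
      = m * (m + 1) * (apR R l).eval (m : R) := by
  induction l with
  | zero =>
    have := Nat.triangle_succ m
    simp only [apR, eval_one]
    have h2 : (m + 1).choose 2 * 2 = m * (m + 1) := by
      rw [Nat.choose_two_right, Nat.add_sub_cancel, Nat.div_mul_cancel (by
        rw [mul_comm]; exact (Nat.even_mul_succ_self m).two_dvd), mul_comm]
    simp only [zero_add, mul_one, Nat.factorial_two, h2]
    push_cast; ring
  | succ l ih =>
    have key : (((m + (l + 2)).choose (2 * (l + 2)) * (2 * (l + 2)).factorial : ℕ) : R)
        = (((m + (l + 1)).choose (2 * (l + 1)) * (2 * (l + 1)).factorial : ℕ) : R)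
          * ((m + (l + 2)) * (m - (l + 1))) := by
      rcases lt_or_ge m (l+1) with h | h
      · rw [Nat.choose_eq_zero_of_lt (by omega), Nat.choose_eq_zero_of_lt (by omega)]
        simp
      · obtain ⟨d, rfl⟩ := Nat.exists_eq_add_of_le h
        rw [mul_comm ((_ : ℕ).choose _), ← Nat.descFactorial_eq_factorial_mul_choose,
          mul_comm ((_ : ℕ).choose _), ← Nat.descFactorial_eq_factorial_mul_choose]
        rw [show 2 * (l + 2) = (2 * (l+1) + 1) + 1 by ring,
          show l + 1 + d + (l + 2) = (l + 1 + d + (l + 1)) + 1 by ring,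
          Nat.succ_descFactorial_succ, Nat.descFactorial_succ,
          show l + 1 + d + (l + 1) - 2 * (l + 1) = d by omega]
        push_cast; ring
    rw [key, ih]
    simp only [apR, eval_mul, eval_add, eval_sub, eval_X, eval_C]
    ring

lemma ap_desc (R : Type*) [CommRing R] (i : ℕ) :
    ∃ e : R[X], ∀ n : ℕ, ((n.choose (i + 1) * (i + 1).factorial : ℕ) : R) = n * e.eval (n : R) := by
  induction i with
  | zero => exact ⟨1, fun n => by simp⟩
  | succ i ih =>
    obtain ⟨e, he⟩ := ih
    refine ⟨e * (X - C (i + 1 : R)), fun n => ?_⟩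
    rw [eval_mul, ← mul_assoc, ← he]
    rw [mul_comm (n.choose _), ← Nat.descFactorial_eq_factorial_mul_choose,
          mul_comm (n.choose _), ← Nat.descFactorial_eq_factorial_mul_choose,
          Nat.descFactorial_succ n (i+1)]
    rcases lt_or_ge n (i+1) with h | h
    · rw [Nat.descFactorial_eq_zero_iff_lt.mpr h]; simp
    · rw [Nat.cast_mul, Nat.cast_sub h]; simp; ring

/-- `S_N(m) = Σ_{l<N} C(m+l,2l) x^l`. -/
def apS {R : Type*} [CommRing R] (x : R) (N m : ℕ) : R :=
  ∑ l ∈ Finset.range N, ((m + l).choose (2 * l) : R) * x ^ l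

def apT {R : Type*} [CommRing R] (x : R) (N m : ℕ) : R :=
  ∑ l ∈ Finset.range N, ((m + 1 + l).choose (2 * l + 1) : R) * x ^ l

lemma apS_form (p : ℕ) [hp : Fact p.Prime] (hp2 : p ≠ 2) (y : ℤ_[p])
    (hy : (p : ℤ_[p]) ^ 2 ∣ y) (N : ℕ) :
    ∃ R : ℤ_[p][X], ∀ m : ℕ, apS (2 * y) (N + 2) m
      = 1 + y * m * ((m + 1) + p * R.eval (m : ℤ_[p])) := by
  have h1 : ∀ l : ℕ, ∃ c : ℤ_[p], (2 * y) ^ (l + 2) = y * p * c * ((2 * (l + 2)).factorial : ℕ) := by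
    intro l
    obtain ⟨y', rfl⟩ := hy
    have hv := ap_val p hp2 (2 * (l + 2)) (by omega)
    obtain ⟨c, hc⟩ := ap_fact_dvd p (2 * (l + 2)) (l + 1) (by omega)
    refine ⟨p ^ l * 2 ^ (l + 2) * y' ^ (l + 1) * c, ?_⟩
    have : ((p:ℤ_[p])) ^ (l + 1) * (p ^ 3 * p ^ l * 2 ^ (l + 2) * y' ^ (l + 2))
      = (((2 * (l + 2)).factorial : ℕ) * c) * (p ^ 3 * p ^ l * 2 ^ (l + 2) * y' ^ (l + 2)) := by
      rw [hc]
    linear_combination this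
  choose c hc using h1
  refine ⟨∑ l ∈ Finset.range N, C (c l) * (X + 1) * apR ℤ_[p] (l + 1), fun m => ?_⟩
  rw [apS, Finset.sum_range_succ', Finset.sum_range_succ', eval_finsetSum, Finset.mul_sum]
  have h2 : ∀ l, (((m + (l + 1 + 1)).choose (2 * (l + 1 + 1)) : ℕ) : ℤ_[p]) * (2 * y) ^ (l + 1 + 1)
      = y * m * (p * (C (c l) * (X + 1) * apR ℤ_[p] (l + 1)).eval (m : ℤ_[p])) := by
    intro l
    have := apR_spec ℤ_[p] (l + 1) m
    rw [hc]
    push_cast at this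
    simp only [eval_mul, eval_add, eval_C, eval_X, eval_one]
    linear_combination (y * p * c l) * this
  rw [Finset.sum_congr rfl (fun l _ => h2 l), ← Finset.mul_sum]
  have h3 := apR_spec ℤ_[p] 0 m
  simp only [apR, eval_one, zero_add, mul_one, Nat.factorial_two] at h3
  push_cast at h3
  simp
  linear_combination y * h3

lemma ap_pow_form (p : ℕ) [hp : Fact p.Prime] (hp2 : p ≠ 2) (y : ℤ_[p])
    (hy : (p : ℤ_[p]) ^ 2 ∣ y) (N : ℕ) :
    ∃ e : ℕ → ℤ_[p][X], ∀ n : ℕ, n < N + 2 → ∀ m W : ℤ_[p],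
      (1 + y * m * W) ^ n = 1 + y * m * n * (W + p *
        ∑ i ∈ Finset.range N, (e i).eval (n : ℤ_[p]) * m ^ (i + 1) * W ^ (i + 2)) := by
  have h1 : ∀ i : ℕ, ∃ c : ℤ_[p], y ^ (i + 2) = y * p * c * ((i + 2).factorial : ℕ) := by
    intro l
    obtain ⟨y', rfl⟩ := hy
    have hv := ap_val p hp2 (l + 2) (by omega)
    obtain ⟨c, hc⟩ := ap_fact_dvd p (l + 2) (l + 1) (by omega)
    refine ⟨p ^ l * y' ^ (l + 1) * c, ?_⟩
    have : ((p:ℤ_[p])) ^ (l + 1) * (p ^ 3 * p ^ l * y' ^ (l + 2))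
      = (((l + 2).factorial : ℕ) * c) * (p ^ 3 * p ^ l * y' ^ (l + 2)) := by
      rw [hc]
    linear_combination this
  choose c hc using h1
  choose e he using fun i => ap_desc ℤ_[p] (i + 1)
  refine ⟨fun i => C (c i) * e i, fun n hn m W => ?_⟩
  have h0 : (1 + y * m * W) ^ n = ∑ i ∈ Finset.range (N + 2), (y * m * W) ^ i * (n.choose i : ℤ_[p]) := by
    rw [add_comm, add_pow]
    simp only [one_pow, mul_one]
    apply Finset.sum_subset
    · intro i; simp; omega
    · intro i _ hi
      simp at hi
      rw [Nat.choose_eq_zero_of_lt (by omega)]; simp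
  rw [h0, Finset.sum_range_succ', Finset.sum_range_succ', Finset.mul_sum]
  have h2 : ∀ i, (y * m * W) ^ (i + 1 + 1) * (n.choose (i + 1 + 1) : ℤ_[p])
      = y * m * n * (p * ((C (c i) * e i).eval (n : ℤ_[p]) * m ^ (i + 1) * W ^ (i + 2))) := by
    intro i
    have := he i n
    push_cast at this
    have h4 := hc i
    simp only [eval_mul, eval_C]
    rw [mul_pow, mul_pow, h4]
    linear_combination (y * p * c i * m ^ (i + 2) * W ^ (i + 2)) * this
  rw [Finset.sum_congr rfl (fun l _ => h2 l), ← Finset.mul_sum]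
  simp
  ring

lemma ap_unique (p : ℕ) [hp : Fact p.Prime] (hp2 : p ≠ 2) (y : ℤ_[p]) (hy0 : y ≠ 0)
    (hy : (p : ℤ_[p]) ^ 2 ∣ y) (N m n : ℕ) (hm : 0 < m) (hn : 0 < n) (hmN : m < N + 2)
    (hnN : n < N + 2)
    (h : apS (2 * y) (N + 2) m ^ n = apS (2 * y) (N + 2) n ^ m) : m = n := by
  obtain ⟨R, hR⟩ := apS_form p hp2 y hy N
  obtain ⟨e, he⟩ := ap_pow_form p hp2 y hy N
  rw [hR, hR, he n hnN, he m hmN] at h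
  have hm0 : (m : ℤ_[p]) ≠ 0 := by exact_mod_cast hm.ne'
  have hn0 : (n : ℤ_[p]) ≠ 0 := by exact_mod_cast hn.ne'
  by_contra hne
  have hne' : ((m : ℤ_[p]) - n) ≠ 0 := by
    rw [sub_ne_zero]; exact_mod_cast hne
  -- the polynomial W
  set W : ℤ_[p][X] := X + 1 + C (p : ℤ_[p]) * R with hW
  have hWe : ∀ t : ℤ_[p], W.eval t = t + 1 + p * R.eval t := by intro t; simp [hW]
  rw [← hWe, ← hWe] at h
  have h' : W.eval (m : ℤ_[p]) + p * ∑ i ∈ Finset.range N,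
        (e i).eval (n : ℤ_[p]) * (m:ℤ_[p]) ^ (i + 1) * (W.eval (m : ℤ_[p])) ^ (i + 2)
      = W.eval (n : ℤ_[p]) + p * ∑ i ∈ Finset.range N,
        (e i).eval (m : ℤ_[p]) * (n:ℤ_[p]) ^ (i + 1) * (W.eval (n : ℤ_[p])) ^ (i + 2) := by
    apply mul_left_cancel₀ (mul_ne_zero (mul_ne_zero hy0 hm0) hn0)
    linear_combination h
  have hd : ((m : ℤ_[p]) - n) ∣ ∑ i ∈ Finset.range N,
        (e i).eval (n : ℤ_[p]) * (m:ℤ_[p]) ^ (i + 1) * (W.eval (m : ℤ_[p])) ^ (i + 2)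
      - ∑ i ∈ Finset.range N,
        (e i).eval (m : ℤ_[p]) * (n:ℤ_[p]) ^ (i + 1) * (W.eval (n : ℤ_[p])) ^ (i + 2) := by
    rw [← Finset.sum_sub_distrib]
    apply Finset.dvd_sum
    intro i _
    obtain ⟨c1, hc1⟩ := sub_dvd_eval_sub (m : ℤ_[p]) n (X ^ (i + 1) * W ^ (i + 2))
    obtain ⟨c2, hc2⟩ := sub_dvd_eval_sub (m : ℤ_[p]) n (e i)
    simp only [eval_mul, eval_pow, eval_X] at hc1
    refine ⟨(e i).eval (n : ℤ_[p]) * c1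
      - c2 * ((n:ℤ_[p]) ^ (i + 1) * (W.eval (n : ℤ_[p])) ^ (i + 2)), ?_⟩
    linear_combination ((e i).eval (n : ℤ_[p])) * hc1
      - ((n:ℤ_[p]) ^ (i + 1) * (W.eval (n : ℤ_[p])) ^ (i + 2)) * hc2
  obtain ⟨c, hc⟩ := hd
  obtain ⟨c', hc'⟩ := sub_dvd_eval_sub (m : ℤ_[p]) n R
  rw [hWe m, hWe n] at h'
  rw [hWe m, hWe n] at hc
  have h5 : ((m : ℤ_[p]) - n) * (1 + p * (c' + c)) = 0 := by
    linear_combination h' - p * hc - p * hc'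
  have h6 : (p : ℤ_[p]) * (-(c' + c)) = 1 := by
    rcases mul_eq_zero.mp h5 with h | h
    · exact absurd h hne'
    · linear_combination -h
  exact PadicInt.prime_p.not_isUnit (IsUnit.of_mul_eq_one _ h6)

lemma apT_succ {R : Type*} [CommRing R] (x : R) (N m : ℕ) :
    apT x N (m + 1) = apS x N (m + 1) + apT x N m := by
  rw [apT, apS, apT, ← Finset.sum_add_distrib]
  apply Finset.sum_congr rfl
  intro l _
  rw [show m + 1 + 1 + l = (m + 1 + l) + 1 by ring, Nat.choose_succ_succ']
  push_cast; ring

lemma apS_succ {R : Type*} [CommRing R] (x : R) (N m : ℕ) (h : m < N) :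
    apS x (N + 1) (m + 1) = x * apT x (N + 1) m + apS x (N + 1) m := by
  have h1 : apT x (N + 1) m = apT x N m := by
    rw [apT, Finset.sum_range_succ, Nat.choose_eq_zero_of_lt (by omega)]
    simp [apT]
  rw [h1, apS, apT, apS, Finset.sum_range_succ', Finset.sum_range_succ' _ N, Finset.mul_sum,
    ← add_assoc, ← Finset.sum_add_distrib]
  congr 1
  · apply Finset.sum_congr rfl
    intro l _
    rw [show m + 1 + (l + 1) = (m + 1 + l) + 1 by ring, show 2 * (l + 1) = (2 * l + 1) + 1 by ring,
      Nat.choose_succ_succ', show m + (l + 1) = m + 1 + l by ring]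
    push_cast; ring
  · simp

/-- Lucas sequence -/
def apU (a Q : ℤ) : ℕ → ℤ
  | 0 => 0
  | 1 => 1
  | (n + 2) => a * apU a Q (n + 1) - Q * apU a Q n

lemma apU_rec (a Q : ℤ) (n : ℕ) : apU a Q (n + 2) = a * apU a Q (n + 1) - Q * apU a Q n := rfl

lemma apU_form {R : Type*} [CommRing R] (a Q : ℤ) (x : R) (hx : x * (-Q : R) = a ^ 2) (N m : ℕ)
    (h : m ≤ N) :
    (apU a Q (2 * m + 1) : R) = (-Q : R) ^ m * apS x (N + 1) m ∧
    (apU a Q (2 * m + 2) : R) = a * (-Q : R) ^ m * apT x (N + 1) m := by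
  induction m with
  | zero =>
    have h1 : apS x (N + 1) 0 = 1 := by
      rw [apS, Finset.sum_range_succ', Finset.sum_eq_zero]
      · simp
      · intro l _
        rw [Nat.choose_eq_zero_of_lt (by omega)]; simp
    have h2 : apT x (N + 1) 0 = 1 := by
      rw [apT, Finset.sum_range_succ', Finset.sum_eq_zero]
      · simp
      · intro l _
        rw [Nat.choose_eq_zero_of_lt (by omega)]; simp
    simp [h1, h2, apU]
  | succ m ih =>
    obtain ⟨ih1, ih2⟩ := ih (by omega)
    have hS := apS_succ x N m (by omega)
    have hT := apT_succ x (N + 1) m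
    have e1 : (apU a Q (2 * (m + 1) + 1) : R) = (-Q : R) ^ (m + 1) * apS x (N + 1) (m + 1) := by
      rw [show 2 * (m + 1) + 1 = (2 * m + 1) + 2 by ring, apU_rec]
      push_cast
      rw [show 2 * m + 1 + 1 = 2 * m + 2 by ring, ih1, ih2, hS]
      linear_combination (-(-Q : R) ^ m * apT x (N + 1) m) * hx
    refine ⟨e1, ?_⟩
    rw [show 2 * (m + 1) + 2 = (2 * m + 2) + 2 by ring, apU_rec]
    push_cast
    rw [show 2 * m + 2 + 1 = 2 * (m + 1) + 1 by ring, e1, ih2, hT]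
    ring

lemma apU_even_dvd (a Q : ℤ) (m : ℕ) : a ∣ apU a Q (2 * m) := by
  induction m with
  | zero => simp [apU]
  | succ m ih =>
    rw [show 2 * (m + 1) = 2 * m + 2 by ring, apU_rec]
    exact dvd_sub (dvd_mul_right _ _) (ih.mul_left _)

lemma apU_mod (a Q : ℤ) (n : ℕ) : Q ∣ apU a Q (n + 1) - a ^ n := by
  induction n with
  | zero => simp [apU]
  | succ n ih =>
    rw [show n + 1 + 1 = n + 2 by ring, apU_rec]
    obtain ⟨c, hc⟩ := ih
    exact ⟨a * c - apU a Q n, by linear_combination a * hc⟩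

lemma apU_mod2 (Q : ℤ) (n : ℕ) : Q ^ 2 ∣ apU 1 Q (n + 2) - (1 - n * Q) := by
  induction n with
  | zero => simp [apU]
  | succ n ih =>
    rw [show n + 1 + 2 = (n + 1) + 2 by ring, apU_rec]
    obtain ⟨c, hc⟩ := ih
    obtain ⟨d, hd⟩ := apU_mod 1 Q n
    rw [one_pow] at hd
    refine ⟨c - d, ?_⟩
    push_cast
    rw [show n + 1 + 1 = n + 2 by ring]
    linear_combination hc - Q * hd

lemma apU_add (a Q : ℤ) (m n : ℕ) :
    apU a Q (m + n + 1) = apU a Q (m + 1) * apU a Q (n + 1) - Q * apU a Q m * apU a Q n ∧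
    apU a Q (m + n + 2) = apU a Q (m + 1) * apU a Q (n + 2) - Q * apU a Q m * apU a Q (n + 1) := by
  induction n with
  | zero =>
    simp [apU]
    ring
  | succ n ih =>
    obtain ⟨h1, h2⟩ := ih
    refine ⟨h2, ?_⟩
    rw [show m + (n + 1) + 2 = (m + n + 1) + 2 by ring, apU_rec,
      show m + n + 1 + 1 = m + n + 2 by ring, h1, h2, show n + 1 + 2 = (n + 1) + 2 by ring,
      apU_rec a Q (n + 1), show n + 1 + 1 = n + 2 by ring, apU_rec a Q n]
    ring

lemma apU_double (a Q : ℤ) (m : ℕ) :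
    apU a Q (2 * m) = apU a Q m * (2 * apU a Q (m + 1) - a * apU a Q m) := by
  cases m with
  | zero => simp [apU]
  | succ m =>
    rw [show 2 * (m + 1) = (m + 1) + m + 1 by ring, (apU_add a Q (m + 1) m).1,
      show m + 1 + 1 = m + 2 by ring, apU_rec]
    ring

lemma apU_one (k : ℕ) (hk : 2 ≤ k) (j : ℕ) (hj : 0 < j)
    (h : apU 1 (2 ^ k) j = 1 ∨ apU 1 (2 ^ k) j = -1) : j ≤ 2 := by
  induction j using Nat.strong_induction_on with
  | _ j ih =>
  by_contra hlt
  obtain ⟨n, rfl⟩ : ∃ n, j = n + 2 := ⟨j - 2, by omega⟩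
  obtain ⟨k, rfl⟩ : ∃ k', k = k' + 2 := ⟨k - 2, by omega⟩
  set Q : ℤ := 2 ^ (k + 2) with hQ
  have hQ4 : (4 : ℤ) ∣ Q := ⟨2 ^ k, by rw [hQ]; ring⟩
  have hQpos : (0 : ℤ) < Q := by positivity
  have hQ4' : (4 : ℤ) ≤ Q := Int.le_of_dvd hQpos hQ4
  have hmod := apU_mod2 Q n
  have h1 : apU 1 Q (n + 2) = 1 := by
    rcases h with h | h
    · exact h
    · have := hQ4.trans (apU_mod 1 Q (n + 1))
      rw [show n + 1 + 1 = n + 2 by ring, h] at this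
      norm_num at this
  rw [h1] at hmod
  obtain ⟨c, hc⟩ := hmod
  have h2 : (n : ℤ) = Q * c := by
    apply mul_left_cancel₀ hQpos.ne'
    linear_combination hc
  have h3 : (4 : ℤ) ∣ n := h2 ▸ hQ4.mul_right c
  obtain ⟨m, hm⟩ : ∃ m, n + 2 = 2 * m := ⟨n / 2 + 1, by omega⟩
  have hd := apU_double 1 Q m
  rw [← hm, h1] at hd
  have hu : IsUnit (apU 1 Q m) := IsUnit.of_mul_eq_one _ hd.symm
  have hm2 := ih m (by omega) (by omega) (Int.isUnit_iff.mp hu)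
  have hm' : m = 2 := by omega
  subst hm'
  simp [apU] at hd
  omega

lemma ap_odd_unique (a k m n : ℕ) (ha : Odd a) (ha1 : a ≠ 1) (hm : 0 < m) (hn : 0 < n)
    (h1 : apU a (2 ^ k) (2 * m + 1) = 1) (h2 : apU a (2 ^ k) (2 * n + 1) = 1) : m = n := by
  obtain ⟨p, hp, hpa⟩ := Nat.exists_prime_and_dvd ha1
  have : Fact p.Prime := ⟨hp⟩
  have hp2 : p ≠ 2 := by
    rintro rfl
    exact (Nat.not_even_iff_odd.mpr ha) (even_iff_two_dvd.mpr hpa)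
  have hu2 : IsUnit (2 : ℤ_[p]) := by
    rw [PadicInt.isUnit_iff]
    have hd : ¬ ((p : ℤ) ∣ 2) := by
      intro h
      have h' : p ∣ 2 := by exact_mod_cast h
      exact hp2 ((Nat.prime_dvd_prime_iff_eq hp Nat.prime_two).mp h')
    have := (PadicInt.norm_int_lt_one_iff_dvd (p := p) 2).not.mpr hd
    push_cast at this
    exact le_antisymm (PadicInt.norm_le_one _) (not_lt.mp this)
  have hu : IsUnit (2 * (-(2 : ℤ_[p]) ^ k)) := hu2.mul (hu2.pow k).neg
  obtain ⟨w, hw⟩ := hu.exists_right_inv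
  have ha0 : (a : ℤ_[p]) ≠ 0 := by
    have : a ≠ 0 := by rintro rfl; simp at ha
    exact_mod_cast this
  have hw0 : w ≠ 0 := by
    rintro rfl
    simp at hw
  obtain ⟨b, hb⟩ := hpa
  set N := m + n with hN
  have hx : (2 * ((a : ℤ_[p]) ^ 2 * w)) * (-((2 ^ k : ℤ) : ℤ_[p])) = ((a : ℤ) : ℤ_[p]) ^ 2 := by
    push_cast
    linear_combination (a : ℤ_[p]) ^ 2 * hw
  have f1 := (apU_form (a : ℤ) (2 ^ k) _ hx (N + 1) m (by omega)).1
  have f2 := (apU_form (a : ℤ) (2 ^ k) _ hx (N + 1) n (by omega)).1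
  rw [h1] at f1
  rw [h2] at f2
  refine ap_unique p hp2 ((a : ℤ_[p]) ^ 2 * w) (mul_ne_zero (pow_ne_zero _ ha0) hw0)
    ⟨b ^ 2 * w, by rw [hb]; push_cast; ring⟩ N m n hm hn (by omega) (by omega) ?_
  have hB : (-((2 ^ k : ℤ) : ℤ_[p])) ^ (m * n) ≠ 0 := by
    apply pow_ne_zero
    rw [neg_ne_zero]
    push_cast
    exact (hu2.pow k).ne_zero
  apply mul_left_cancel₀ hB
  have g1 : ((1 : ℤ) : ℤ_[p]) ^ n = ((1 : ℤ) : ℤ_[p]) ^ m := by simp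
  conv_lhs at g1 => rw [f1]
  conv_rhs at g1 => rw [f2]
  rw [mul_pow, mul_pow, ← pow_mul, ← pow_mul, mul_comm n m] at g1
  exact g1

/-- existence of `j` with `(s,t)` equal to `γ^j` up to signs. -/
lemma ap_descent (D a b k : ℕ) (hD : 7 < D) (hk : 0 < k) (ha : Odd a) (hb : Odd b)
    (hab : a ^ 2 + D * b ^ 2 = 2 ^ (k + 2))
    (hmin : ∀ m s t : ℕ, 0 < m → m < k → Odd s → Odd t → s ^ 2 + D * t ^ 2 ≠ 2 ^ (m + 2)) :
    ∀ (m : ℕ) (s t : ℤ), ((Odd s ∧ Odd t) ∨ m = 0) → s ^ 2 + D * t ^ 2 = 2 ^ (m + 2) →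
    ∃ (j : ℕ) (e f : ℤ), m = k * j ∧ (e = 1 ∨ e = -1) ∧ (f = 1 ∨ f = -1) ∧
      s = e * (2 * apU a (2 ^ k) (j + 1) - a * apU a (2 ^ k) j) ∧
      t = f * (b * apU a (2 ^ k) j) := by
  intro m
  induction m using Nat.strong_induction_on with
  | _ m ih =>
  intro s t hodd hst
  rcases Nat.eq_zero_or_pos m with rfl | hmpos
  · -- base
    have ht : t = 0 := by
      by_contra ht
      have : 1 ≤ t ^ 2 := by
        have := sq_pos_of_ne_zero ht
        omega
      have hD' : (7 : ℤ) < D := by exact_mod_cast hD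
      norm_num at hst
      nlinarith [sq_nonneg s]
    subst ht
    have hs : (s - 2) * (s + 2) = 0 := by
      norm_num at hst
      linear_combination hst
    rcases mul_eq_zero.mp hs with h | h
    · exact ⟨0, 1, 1, by simp, by simp, by simp, by simp [apU]; linarith, by simp [apU]⟩
    · exact ⟨0, -1, 1, by simp, by simp, by simp, by simp [apU]; linarith, by simp [apU]⟩
  · obtain ⟨hs, ht⟩ : Odd s ∧ Odd t := by
      rcases hodd with h | h
      · exact h
      · omega
    have hmk : k ≤ m := by
      by_contra hlt
      refine hmin m s.natAbs t.natAbs hmpos (by omega) (Int.natAbs_odd.mpr hs)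
        (Int.natAbs_odd.mpr ht) ?_
      zify
      simpa using hst
    have haZ : Odd (a : ℤ) := by exact_mod_cast ha
    have hbZ : Odd (b : ℤ) := by exact_mod_cast hb
    have habZ : (a : ℤ) ^ 2 + D * b ^ 2 = 2 ^ (k + 2) := by exact_mod_cast hab
    -- reduce to the sign choice
    have main : ∀ s : ℤ, Odd s → s ^ 2 + D * t ^ 2 = 2 ^ (m + 2) →
        (2 : ℤ) ^ (k + 1) ∣ t * a - s * b →
        ∃ (j : ℕ) (e f : ℤ), m = k * j ∧ (e = 1 ∨ e = -1) ∧ (f = 1 ∨ f = -1) ∧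
        s = e * (2 * apU a (2 ^ k) (j + 1) - a * apU a (2 ^ k) j) ∧
        t = f * (b * apU a (2 ^ k) j) := by
      intro s hs hst hdvd
      obtain ⟨t', ht'⟩ := hdvd
      obtain ⟨d, rfl⟩ := Nat.exists_eq_add_of_le hmk
      have hP : (2 : ℤ) ^ (k + 1) ≠ 0 := by positivity
      have hsdvd : (2 : ℤ) ^ (k + 1) ∣ s * a + D * t * b := by
        have hcop : IsCoprime ((2 : ℤ) ^ (k + 1)) b := by
          apply IsCoprime.pow_left
          obtain ⟨q, hq⟩ := hbZ
          exact ⟨-q, 1, by rw [hq]; ring⟩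
        apply hcop.dvd_of_dvd_mul_right
        refine ⟨2 * t - t' * a, ?_⟩
        linear_combination t * habZ - a * ht'
      obtain ⟨s', hs'⟩ := hsdvd
      have e1 : 2 * s = a * s' - D * b * t' := by
        apply mul_left_cancel₀ hP
        linear_combination -s * habZ + a * hs' - D * b * ht'
      have e2 : 2 * t = a * t' + b * s' := by
        apply mul_left_cancel₀ hP
        linear_combination -t * habZ + a * ht' + b * hs'
      have hn : s' ^ 2 + D * t' ^ 2 = 2 ^ (d + 2) := by
        apply mul_left_cancel₀ (show (2 : ℤ) ^ (k + 2) ≠ 0 by positivity)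
        have : (2 : ℤ) ^ (k + 2) * 2 ^ (d + 2) = 4 * 2 ^ (k + d + 2) := by ring
        rw [this, ← hst, ← habZ]
        linear_combination (-(2 * s + a * s' - D * b * t')) * e1 - D * (2 * t + a * t' + b * s') * e2
      have hpar : (Odd s' ∧ Odd t') ∨ d = 0 := by
        rcases Nat.eq_zero_or_pos d with h | hdpos
        · right; exact h
        left
        by_contra hcon
        have hbs : Even (a * t' + b * s') := ⟨t, by linarith⟩
        have hpp : Even s' ∧ Even t' := by
          rw [Int.even_add, Int.even_mul, Int.even_mul] at hbs
          simp only [← Int.not_even_iff_odd] at *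
          tauto
        obtain ⟨⟨x, hx⟩, ⟨y, hy⟩⟩ := hpp
        have hxy : x ^ 2 + D * y ^ 2 = 2 ^ d := by
          rw [hx, hy] at hn
          have : (2 : ℤ) ^ (d + 2) = 4 * 2 ^ d := by ring
          rw [this] at hn
          linarith
        have hDodd : Odd (D : ℤ) := by
          have : Even ((a : ℤ) ^ 2 + D * b ^ 2) := by
            rw [habZ]; exact ⟨2 ^ (k + 1), by ring⟩
          rw [Int.even_add, Int.even_mul, Int.even_pow, Int.even_pow] at this
          simp only [← Int.not_even_iff_odd] at *
          tauto
        have h2e : Even (x ^ 2 + D * y ^ 2) := by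
          rw [hxy]
          exact (even_two).pow_of_ne_zero (by omega)
        have hxy2 : Even (a * y + b * x) := by
          rw [Int.even_add, Int.even_mul, Int.even_pow, Int.even_pow] at h2e
          rw [Int.even_add, Int.even_mul, Int.even_mul]
          simp only [← Int.not_even_iff_odd] at *
          tauto
        have : t = a * y + b * x := by
          rw [hx, hy] at e2
          linarith
        rw [← this] at hxy2
        exact (Int.not_even_iff_odd.mpr ht) hxy2
      obtain ⟨j, e, f, hj, he, hf, hs2, ht2⟩ := ih d (by omega) s' t' hpar hn
      have hQ : 4 * (2 : ℤ) ^ k = a ^ 2 + D * b ^ 2 := by rw [habZ]; ring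
      by_cases hef : e = f
      · subst hef
        refine ⟨j + 1, e, e, by rw [hj]; ring, he, he, ?_, ?_⟩
        · rw [show j + 1 + 1 = j + 2 by ring, apU_rec]
          rw [hs2, ht2] at e1
          linarith [show (a * (e * (2 * apU a (2 ^ k) (j + 1) - a * apU a (2 ^ k) j))
            - D * b * (e * (b * apU a (2 ^ k) j)) : ℤ)
            = 2 * (e * (2 * (a * apU a (2 ^ k) (j + 1) - 2 ^ k * apU a (2 ^ k) j)
              - a * apU a (2 ^ k) (j + 1))) by
              linear_combination e * apU a (2 ^ k) j * hQ]
        · rw [hs2, ht2] at e2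
          linarith
      · have hfe : f = -e := by
          rcases he with rfl | rfl <;> rcases hf with rfl | rfl <;> simp_all
        subst hfe
        cases j with
        | zero =>
          -- f is irrelevant
          simp only [apU] at hs2 ht2
          refine ⟨1, e, e, by omega, he, he, ?_, ?_⟩
          · simp [apU]
            rw [hs2, ht2] at e1
            have hh : s = e * a := by linarith
            rw [hh]; ring
          · simp [apU]
            rw [hs2, ht2] at e2
            linarith
        | succ i =>
          exfalso
          rw [show i + 1 + 1 = i + 2 by ring, apU_rec] at hs2
          have : t = -e * b * 2 ^ k * apU a (2 ^ k) i := by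
            rw [hs2, ht2] at e2
            linarith
          apply Int.not_even_iff_odd.mpr ht
          obtain ⟨k', rfl⟩ : ∃ k', k = k' + 1 := ⟨k - 1, by omega⟩
          rw [this]
          refine ⟨-e * b * 2 ^ k' * apU a (2 ^ (k' + 1)) i, by ring⟩
    -- choose the sign
    have hdiv : (2 : ℤ) ^ (k + 1) ∣ t * a - s * b ∨ (2 : ℤ) ^ (k + 1) ∣ t * a + s * b := by
      have hprod : (2 : ℤ) ^ (k + 2) ∣ (t * a - s * b) * (t * a + s * b) := by
        obtain ⟨d, rfl⟩ := Nat.exists_eq_add_of_le hmk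
        refine ⟨t ^ 2 - b ^ 2 * 2 ^ d, ?_⟩
        have : (2 : ℤ) ^ (k + d + 2) = 2 ^ (k + 2) * 2 ^ d := by ring
        rw [this] at hst
        linear_combination t ^ 2 * habZ - b ^ 2 * hst
      obtain ⟨u, hu⟩ := (ht.mul haZ).sub_odd (hs.mul hbZ)
      obtain ⟨v, hv⟩ := (ht.mul haZ).add_odd (hs.mul hbZ)
      have hu' : t * a - s * b = 2 * u := by rw [hu]; ring
      have hv' : t * a + s * b = 2 * v := by rw [hv]; ring
      rw [hu', hv'] at hprod ⊢
      have huv : (2 : ℤ) ^ k ∣ u * v := by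
        obtain ⟨c, hc⟩ := hprod
        refine ⟨c, ?_⟩
        apply mul_left_cancel₀ (show (4 : ℤ) ≠ 0 by norm_num)
        linear_combination hc
      have hodd : Odd (u + v) := by
        have : u + v = t * a := by linarith
        rw [this]; exact ht.mul haZ
      have hcop2 : ∀ w : ℤ, Odd w → IsCoprime ((2 : ℤ) ^ k) w := by
        intro w hw
        apply IsCoprime.pow_left
        obtain ⟨q, rfl⟩ := hw
        exact ⟨-q, 1, by ring⟩
      rw [show (2 : ℤ) ^ (k + 1) = 2 * 2 ^ k by ring]
      rcases Int.even_or_odd u with h | h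
      · have hvo : Odd v := by
          rw [Int.odd_add'] at hodd
          exact hodd.mpr h
        left
        exact mul_dvd_mul_left _ ((hcop2 v hvo).dvd_of_dvd_mul_right huv)
      · right
        exact mul_dvd_mul_left _ ((hcop2 u h).dvd_of_dvd_mul_left huv)
    rcases hdiv with h | h
    · exact main s hs hst h
    · obtain ⟨j, e, f, h1, h2, h3, h4, h5⟩ := main (-s) hs.neg (by rw [neg_sq]; exact hst)
        (by rw [show t * a - -s * b = t * a + s * b by ring]; exact h)
      refine ⟨j, -e, f, h1, ?_, h3, by linarith, h5⟩
      rcases h2 with rfl | rfl <;> simp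

/-- the main index theorem -/
lemma ap_three (D : ℕ) (hodd : Odd D) (hD : 7 < D) (z₁ z₂ z₃ n₁ n₂ n₃ : ℕ)
    (h₁ : z₁ ^ 2 + D = 2 ^ (n₁ + 2)) (h₂ : z₂ ^ 2 + D = 2 ^ (n₂ + 2))
    (h₃ : z₃ ^ 2 + D = 2 ^ (n₃ + 2)) (p₁ : 0 < n₁) (h12 : n₁ < n₂) (h23 : n₂ < n₃) : False := by
  classical
  have zodd : ∀ z n : ℕ, z ^ 2 + D = 2 ^ (n + 2) → Odd z := by
    intro z n h
    have he : Even (z ^ 2 + D) := by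
      rw [h]; exact even_two.pow_of_ne_zero (by omega)
    rw [Nat.even_add, Nat.even_pow] at he
    simp only [← Nat.not_even_iff_odd] at *
    tauto
  have hex : ∃ m, 0 < m ∧ ∃ s t : ℕ, Odd s ∧ Odd t ∧ s ^ 2 + D * t ^ 2 = 2 ^ (m + 2) :=
    ⟨n₁, p₁, z₁, 1, zodd _ _ h₁, odd_one, by simpa using h₁⟩
  obtain ⟨hk, a, b, ha, hb, hab⟩ := Nat.find_spec hex
  have hmin := fun m (h : m < Nat.find hex) => Nat.find_min hex h
  generalize Nat.find hex = k at hk hab hmin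
  have hmin' : ∀ m s t : ℕ, 0 < m → m < k → Odd s → Odd t → s ^ 2 + D * t ^ 2 ≠ 2 ^ (m + 2) := by
    intro m s t hm hmk hs ht h
    exact hmin m hmk ⟨hm, s, t, hs, ht, h⟩
  have hdesc := ap_descent D a b k hD hk ha hb hab hmin'
  have step : ∀ z n : ℕ, z ^ 2 + D = 2 ^ (n + 2) → 0 < n →
      ∃ j, n = k * j ∧ 0 < j ∧ b = 1 ∧ (apU a (2 ^ k) j = 1 ∨ apU a (2 ^ k) j = -1) := by
    intro z n h hn
    obtain ⟨j, e, f, hj, he, hf, hs, ht⟩ := hdesc n z 1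
      (Or.inl ⟨by exact_mod_cast zodd z n h, odd_one⟩) (by
        have : (z : ℤ) ^ 2 + D = 2 ^ (n + 2) := by exact_mod_cast h
        simpa using this)
    have hbu : IsUnit (b : ℤ) := IsUnit.of_mul_eq_one (f * apU a (2 ^ k) j) (by linarith)
    have hju : IsUnit (apU a (2 ^ k) j) := IsUnit.of_mul_eq_one (f * b) (by linarith)
    refine ⟨j, hj, ?_, ?_, Int.isUnit_iff.mp hju⟩
    · rcases Nat.eq_zero_or_pos j with rfl | h
      · omega
      · exact h
    · have := Int.isUnit_iff.mp hbu
      omega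
  obtain ⟨j₁, e₁, q₁, hb1, u₁⟩ := step _ _ h₁ p₁
  obtain ⟨j₂, e₂, q₂, -, u₂⟩ := step _ _ h₂ (by omega)
  obtain ⟨j₃, e₃, q₃, -, u₃⟩ := step _ _ h₃ (by omega)
  have j12 : j₁ < j₂ := by
    rw [e₁, e₂] at h12
    exact lt_of_mul_lt_mul_left h12 (Nat.zero_le _)
  have j23 : j₂ < j₃ := by
    rw [e₂, e₃] at h23
    exact lt_of_mul_lt_mul_left h23 (Nat.zero_le _)
  have hk2 : 2 ≤ k := by
    by_contra hlt
    have : k = 1 := by omega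
    subst this
    subst hb1
    have : 0 < a := ha.pos
    have : 0 < a ^ 2 := by positivity
    norm_num at hab
    omega
  by_cases ha1 : a = 1
  · subst ha1
    have := apU_one k hk2 j₃ q₃ u₃
    omega
  · have oddj : ∀ j, 0 < j → (apU a (2 ^ k) j = 1 ∨ apU a (2 ^ k) j = -1) →
        ∃ m, j = 2 * m + 1 ∧ apU a (2 ^ k) (2 * m + 1) = 1 := by
      intro j hj hu
      rcases Nat.even_or_odd' j with ⟨m, rfl | rfl⟩
      · exfalso
        have h1 := apU_even_dvd a (2 ^ k) m
        have h2 := isUnit_of_dvd_unit h1 (Int.isUnit_iff.mpr hu)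
        have := Int.isUnit_iff.mp h2
        omega
      · refine ⟨m, rfl, ?_⟩
        rcases hu with hu | hu
        · exact hu
        · exfalso
          have h4 : (4 : ℤ) ∣ 2 ^ k := by
            obtain ⟨k', rfl⟩ : ∃ k', k = k' + 2 := ⟨k - 2, by omega⟩
            exact ⟨2 ^ k', by ring⟩
          have h1 := h4.trans (apU_mod a (2 ^ k) (2 * m))
          rw [hu] at h1
          have h5 : (4 : ℤ) ∣ (a : ℤ) ^ (2 * m) - 1 := by
            obtain ⟨c, hc⟩ := ha
            have : (4 : ℤ) ∣ (a : ℤ) ^ 2 - 1 := ⟨c ^ 2 + c, by rw [hc]; push_cast; ring⟩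
            rw [pow_mul]
            exact this.trans (by simpa using sub_dvd_pow_sub_pow ((a : ℤ) ^ 2) 1 m)
          omega
    obtain ⟨m₂, rfl, v₂⟩ := oddj _ q₂ u₂
    obtain ⟨m₃, rfl, v₃⟩ := oddj _ q₃ u₃
    have := ap_odd_unique a k m₂ m₃ ha ha1 (by omega) (by omega) v₂ v₃
    omega

/-- Apéry's theorem: for odd positive `D ≠ 7`, the equation `z² + D = 2ⁿ` has at
most two solutions in positive integers `(z, n)`. -/
theorem apery_at_most_two_solutions
    (D : ℕ) (hpos : 0 < D) (hodd : Odd D) (hD : D ≠ 7) :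
    {p : ℕ × ℕ | 0 < p.1 ∧ 0 < p.2 ∧ p.1 ^ 2 + D = 2 ^ p.2}.encard ≤ 2 := by
  by_contra hcon
  rw [not_le] at hcon
  have hcon' := Order.add_one_le_of_lt hcon
  obtain ⟨s, hs, hs3⟩ := Set.exists_subset_encard_eq hcon'
  rw [show (2 : ℕ∞) + 1 = 3 by norm_num, Set.encard_eq_three] at hs3
  obtain ⟨⟨z₁, n₁⟩, ⟨z₂, n₂⟩, ⟨z₃, n₃⟩, h12, h13, h23, rfl⟩ := hs3
  obtain ⟨a₁, b₁, c₁⟩ := hs (show (z₁, n₁) ∈ _ by simp)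
  obtain ⟨a₂, b₂, c₂⟩ := hs (show (z₂, n₂) ∈ _ by simp)
  obtain ⟨a₃, b₃, c₃⟩ := hs (show (z₃, n₃) ∈ _ by simp)
  simp only at a₁ b₁ c₁ a₂ b₂ c₂ a₃ b₃ c₃
  have inj : ∀ z n z' n' : ℕ, z ^ 2 + D = 2 ^ n → z' ^ 2 + D = 2 ^ n' → (z, n) ≠ (z', n') →
      n ≠ n' := by
    intro z n z' n' h h' hne hnn
    subst hnn
    apply hne
    have : z ^ 2 = z' ^ 2 := by omega
    rw [Nat.pow_left_injective (n := 2) (by norm_num) this]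
  have i12 := inj _ _ _ _ c₁ c₂ h12
  have i13 := inj _ _ _ _ c₁ c₃ h13
  have i23 := inj _ _ _ _ c₂ c₃ h23
  -- some exponent is at least three
  have sq8 : ∀ z n : ℕ, 0 < n → z ^ 2 + D = 2 ^ n → z ^ 2 % 8 = 1 := by
    intro z n hn h
    have he : Even (z ^ 2 + D) := by
      rw [h]; exact even_two.pow_of_ne_zero (by omega)
    have hz : Odd z := by
      rw [Nat.even_add, Nat.even_pow] at he
      simp only [← Nat.not_even_iff_odd] at *
      tauto
    have h8 : z % 8 = 1 ∨ z % 8 = 3 ∨ z % 8 = 5 ∨ z % 8 = 7 := by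
      obtain ⟨q, hq⟩ := hz
      omega
    rw [Nat.pow_mod]
    rcases h8 with h | h | h | h <;> rw [h]
  have hmod : D % 8 = 7 := by
    have aux : ∀ z n : ℕ, 3 ≤ n → z ^ 2 + D = 2 ^ n → D % 8 = 7 := by
      intro z n hn h
      have h1 := sq8 z n (by omega) h
      obtain ⟨d, rfl⟩ := Nat.exists_eq_add_of_le hn
      rw [pow_add] at h
      omega
    rcases (show 3 ≤ n₁ ∨ 3 ≤ n₂ ∨ 3 ≤ n₃ by omega) with h | h | h
    · exact aux _ _ h c₁
    · exact aux _ _ h c₂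
    · exact aux _ _ h c₃
  have big : ∀ z n : ℕ, 0 < z → 0 < n → z ^ 2 + D = 2 ^ n → 3 ≤ n := by
    intro z n hz hn h
    by_contra hlt
    have : 2 ^ n ≤ 2 ^ 2 := Nat.pow_le_pow_right (by norm_num) (by omega)
    omega
  have g₁ := big _ _ a₁ b₁ c₁
  have g₂ := big _ _ a₂ b₂ c₂
  have g₃ := big _ _ a₃ b₃ c₃
  have hD7 : 7 < D := by omega
  obtain ⟨m₁, rfl⟩ : ∃ m, n₁ = m + 2 := ⟨n₁ - 2, by omega⟩
  obtain ⟨m₂, rfl⟩ : ∃ m, n₂ = m + 2 := ⟨n₂ - 2, by omega⟩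
  obtain ⟨m₃, rfl⟩ : ∃ m, n₃ = m + 2 := ⟨n₃ - 2, by omega⟩
  have T := ap_three D hodd hD7
  rcases lt_or_gt_of_ne i12 with h | h <;> rcases lt_or_gt_of_ne i13 with h' | h' <;>
    rcases lt_or_gt_of_ne i23 with h'' | h'' <;> first
    | omega
    | exact T _ _ _ _ _ _ c₁ c₂ c₃ (by omega) (by omega) (by omega)
    | exact T _ _ _ _ _ _ c₁ c₃ c₂ (by omega) (by omega) (by omega)
    | exact T _ _ _ _ _ _ c₂ c₁ c₃ (by omega) (by omega) (by omega)
    | exact T _ _ _ _ _ _ c₂ c₃ c₁ (by omega) (by omega) (by omega)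
    | exact T _ _ _ _ _ _ c₃ c₁ c₂ (by omega) (by omega) (by omega)
    | exact T _ _ _ _ _ _ c₃ c₂ c₁ (by omega) (by omega) (by omega)
end

section
/- Let D be an odd positive integer. The equation z² + D = 2ⁿ has exactly two solutions in positive integers (z, n) if and only if D = 23 or D = 2^k − 1 for some integer k > 3. In the latter case the two solutions are (z, n) = (1, k) and (z, n) = (2^{k−1} − 1, 2k − 2). -/
/-! ## Part 1: Padé approximations to `√(1 - z)` -/

/-- The integral giving the remainder of the Padé approximation. -/
noncomputable def padeJ (c : ℝ) (i j : ℕ) : ℝ :=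
  ∫ s in c..1, (1 - s ^ 2) ^ j * (1 - c ^ 2 / s ^ 2) ^ i

lemma padeJ_integrable (c : ℝ) (h0 : 0 < c) (h1 : c < 1) (i j : ℕ) :
    IntervalIntegrable (fun s : ℝ => (1 - s ^ 2) ^ j * (1 - c ^ 2 / s ^ 2) ^ i)
      MeasureTheory.volume c 1 := by
  apply ContinuousOn.intervalIntegrable
  rw [Set.uIcc_of_le h1.le]
  apply ContinuousOn.mul
  · fun_prop
  · apply ContinuousOn.pow
    apply ContinuousOn.sub continuousOn_const
    apply ContinuousOn.div continuousOn_const (by fun_prop)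
    intro s hs
    have : 0 < s := lt_of_lt_of_le h0 hs.1
    positivity

lemma padeJ_rel_a (c : ℝ) (h0 : 0 < c) (h1 : c < 1) (i j : ℕ) :
    padeJ c (i + 1) (j + 1) = padeJ c (i + 1) j + padeJ c i (j + 1) - (1 - c ^ 2) * padeJ c i j := by
  unfold padeJ
  rw [← intervalIntegral.integral_const_mul, ← intervalIntegral.integral_add
    (padeJ_integrable c h0 h1 _ _) (padeJ_integrable c h0 h1 _ _),
    ← intervalIntegral.integral_sub ((padeJ_integrable c h0 h1 _ _).add
      (padeJ_integrable c h0 h1 _ _)) ((padeJ_integrable c h0 h1 _ _).const_mul _)]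
  apply intervalIntegral.integral_congr
  intro s hs
  rw [Set.uIcc_of_le h1.le] at hs
  have hs0 : 0 < s := lt_of_lt_of_le h0 hs.1
  have key : (1 - s ^ 2) * (1 - c ^ 2 / s ^ 2)
      = (1 - s ^ 2) + (1 - c ^ 2 / s ^ 2) - (1 - c ^ 2) := by
    field_simp
    ring
  simp only
  rw [pow_succ, pow_succ]
  linear_combination ((1 - s ^ 2) ^ j * (1 - c ^ 2 / s ^ 2) ^ i) * key

lemma padeJ_rel_b (c : ℝ) (h0 : 0 < c) (h1 : c < 1) (i j : ℕ) :
    (1 - c ^ 2) ^ i * 0 ^ j - c * ((1 - c ^ 2) ^ j * 0 ^ i) =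
      (1 + 2 * j - 2 * i) * padeJ c i j - 2 * j * padeJ c i (j - 1) + 2 * i * padeJ c (i - 1) j := by
  have hInteg := padeJ_integrable c h0 h1
  have hd : ∀ s ∈ Set.uIcc c 1, HasDerivAt
      (fun s : ℝ => s * ((1 - s ^ 2) ^ j * (1 - c ^ 2 / s ^ 2) ^ i))
      ((1 + 2 * j - 2 * i) * ((1 - s ^ 2) ^ j * (1 - c ^ 2 / s ^ 2) ^ i)
        - 2 * j * ((1 - s ^ 2) ^ (j - 1) * (1 - c ^ 2 / s ^ 2) ^ i)
        + 2 * i * ((1 - s ^ 2) ^ j * (1 - c ^ 2 / s ^ 2) ^ (i - 1))) s := by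
    intro s hs
    rw [Set.uIcc_of_le h1.le] at hs
    have hs0 : 0 < s := lt_of_lt_of_le h0 hs.1
    have hX : HasDerivAt (fun s : ℝ => 1 - s ^ 2) (-(2 * s)) s := by
      have := (hasDerivAt_pow 2 s).const_sub 1
      simpa using this
    have hY : HasDerivAt (fun s : ℝ => 1 - c ^ 2 / s ^ 2) (2 * c ^ 2 / s ^ 3) s := by
      have h := (((hasDerivAt_pow 2 s).fun_inv (by positivity)).const_mul (c ^ 2)).const_sub 1
      simp only [← div_eq_mul_inv] at h
      refine h.congr_deriv ?_
      field_simp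
      norm_num
      ring
    have hXj := hX.fun_pow j
    have hYi := hY.fun_pow i
    have h := (hasDerivAt_id' s).fun_mul (hXj.fun_mul hYi)
    refine h.congr_deriv ?_
    have e1 : (j : ℝ) * (1 - s ^ 2) ^ j = j * ((1 - s ^ 2) * (1 - s ^ 2) ^ (j - 1)) := by
      rcases j with _ | j
      · simp
      · simp [pow_succ']
    have e2 : (i : ℝ) * (1 - c ^ 2 / s ^ 2) ^ i
        = i * ((1 - c ^ 2 / s ^ 2) * (1 - c ^ 2 / s ^ 2) ^ (i - 1)) := by
      rcases i with _ | i
      · simp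
      · simp [pow_succ']
    have e3 : s * (2 * c ^ 2 / s ^ 3) = 2 * (c ^ 2 / s ^ 2) := by
      field_simp
    linear_combination -(2 * (1 - c ^ 2 / s ^ 2) ^ i) * e1 + (2 * (1 - s ^ 2) ^ j) * e2
      + ((1 - s ^ 2) ^ j * i * (1 - c ^ 2 / s ^ 2) ^ (i - 1)) * e3
  have hftc := intervalIntegral.integral_eq_sub_of_hasDerivAt hd
    ((((hInteg i j).const_mul _).sub ((hInteg i (j - 1)).const_mul _)).add
      ((hInteg (i - 1) j).const_mul _))
  rw [intervalIntegral.integral_add (((hInteg i j).const_mul _).sub ((hInteg i (j - 1)).const_mul _))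
      ((hInteg (i - 1) j).const_mul _),
    intervalIntegral.integral_sub ((hInteg i j).const_mul _) ((hInteg i (j - 1)).const_mul _),
    intervalIntegral.integral_const_mul, intervalIntegral.integral_const_mul,
    intervalIntegral.integral_const_mul] at hftc
  unfold padeJ
  rw [hftc]
  have : c ^ 2 / c ^ 2 = 1 := div_self (by positivity)
  simp only [this]
  norm_num
  ring

/-- Normalised central binomial coefficient. -/
noncomputable def padeW (i : ℕ) : ℝ := (Nat.centralBinom i : ℝ) / 4 ^ i

lemma padeW_succ (i : ℕ) : (2 * (i : ℝ) + 2) * padeW (i + 1) = (2 * i + 1) * padeW i := by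
  unfold padeW
  have h := Nat.succ_mul_centralBinom_succ i
  have h' : ((i : ℝ) + 1) * (Nat.centralBinom (i + 1) : ℝ)
      = 2 * (2 * i + 1) * Nat.centralBinom i := by exact_mod_cast h
  rw [pow_succ]
  field_simp
  linear_combination 2 * h'

lemma padeW_pos (i : ℕ) : 0 < padeW i := by
  unfold padeW
  have := Nat.centralBinom_pos i
  positivity

lemma padeW_le (i : ℕ) : padeW i ≤ 1 := by
  induction i with
  | zero => simp [padeW]
  | succ i ih =>
    have h := padeW_succ i
    have h2 := padeW_pos i
    by_contra hc
    push Not at hc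
    have hi : (0 : ℝ) ≤ i := Nat.cast_nonneg i
    nlinarith

/-- Padé numerators. -/
noncomputable def padeA (z : ℝ) : ℕ → ℕ → ℝ
  | 0, _ => 1
  | i + 1, 0 => padeA z i 0 - 2 * (catalan i : ℝ) * (z / 4) ^ (i + 1)
  | i + 1, j + 1 => padeA z i (j + 1) + padeA z (i + 1) j - z * padeA z i j

/-- Padé denominators. -/
noncomputable def padeB (z : ℝ) : ℕ → ℕ → ℝ
  | 0, 0 => 1
  | 0, j + 1 => padeB z 0 j + (Nat.centralBinom (j + 1) : ℝ) * (z / 4) ^ (j + 1)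
  | _ + 1, 0 => 1
  | i + 1, j + 1 => padeB z i (j + 1) + padeB z (i + 1) j - z * padeB z i j

lemma pade_identity (c : ℝ) (h0 : 0 < c) (h1 : c < 1) (i j : ℕ) :
    (2 * j + 1) * padeW j * padeW i * padeJ c i j
      = padeA (1 - c ^ 2) i j - c * padeB (1 - c ^ 2) i j := by
  induction i generalizing j with
  | zero =>
    induction j with
    | zero => simp [padeW, padeJ, padeA, padeB]
    | succ j ih =>
      have hb := padeJ_rel_b c h0 h1 0 (j + 1)
      have hw := padeW_succ j
      have e : padeW (j + 1) * (1 - c ^ 2) ^ (j + 1)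
          = (Nat.centralBinom (j + 1) : ℝ) * ((1 - c ^ 2) / 4) ^ (j + 1) := by
        unfold padeW
        rw [div_pow]
        ring
      have ew : padeW 0 = 1 := by simp [padeW]
      simp only [padeA, padeB, ew] at ih ⊢
      simp at hb
      push_cast
      linear_combination ih - c * e - padeW (j + 1) * hb + padeJ c 0 j * hw
  | succ i ihi =>
    induction j with
    | zero =>
      have hb := padeJ_rel_b c h0 h1 (i + 1) 0
      have hw := padeW_succ i
      have ih := ihi 0
      have e : padeW i * (1 - c ^ 2) ^ (i + 1)
          = (2 * (i : ℝ) + 2) * (2 * (catalan i : ℝ) * ((1 - c ^ 2) / 4) ^ (i + 1)) := by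
        have hc := succ_mul_catalan_eq_centralBinom i
        have hc' : ((i : ℝ) + 1) * (catalan i : ℝ) = Nat.centralBinom i := by exact_mod_cast hc
        unfold padeW
        rw [div_pow, ← hc', pow_succ 4]
        field_simp
        ring
      have ew : padeW 0 = 1 := by simp [padeW]
      have eB : padeB (1 - c ^ 2) i 0 = 1 := by cases i <;> simp [padeB]
      simp only [padeA, padeB, ew, eB] at ih ⊢
      simp at hb ih ⊢
      have hne : (2 * (i : ℝ) + 2) ≠ 0 := by positivity
      apply mul_left_cancel₀ hne
      linear_combination padeJ c (i + 1) 0 * hw + padeW i * hb + (2 * (i : ℝ) + 2) * ih - e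
    | succ j ihj =>
      have ha := padeJ_rel_a c h0 h1 i j
      have hb := padeJ_rel_b c h0 h1 (i + 1) (j + 1)
      have hwi := padeW_succ i
      have hwj := padeW_succ j
      have ih1 := ihi (j + 1)
      have ih2 := ihi j
      simp only [padeA, padeB]
      simp at hb
      push_cast at ih1 hb ⊢
      have hi : (2 * (i : ℝ) + 2) ≠ 0 := by positivity
      have hj : (2 * (j : ℝ) + 2) ≠ 0 := by positivity
      have ei : padeW (i + 1) = (2 * i + 1) * padeW i / (2 * (i : ℝ) + 2) := by
        field_simp; linear_combination hwi
      have ej : padeW (j + 1) = (2 * j + 1) * padeW j / (2 * (j : ℝ) + 2) := by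
        field_simp; linear_combination hwj
      have goal' : (2 * ((j : ℝ) + 1) + 1) * padeW (j + 1) * padeW (i + 1) * padeJ c (i + 1) (j + 1)
        = (2 * ((j : ℝ) + 1) + 1) * padeW (j + 1) * padeW i * padeJ c i (j + 1)
        + (2 * (j : ℝ) + 1) * padeW j * padeW (i + 1) * padeJ c (i + 1) j
        - (1 - c ^ 2) * ((2 * (j : ℝ) + 1) * padeW j * padeW i * padeJ c i j) := by
        rw [ei, ej]
        linear_combination (norm := (field_simp; ring)) ((2 * j + 1) * padeW j * padeW i) *
          (ha + hb / ((2 * (i : ℝ) + 2) * (2 * (j : ℝ) + 2)))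
      linear_combination goal' + ih1 + ihj - (1 - c ^ 2) * ih2

lemma padeJ_pos (c : ℝ) (h0 : 0 < c) (h1 : c < 1) (i j : ℕ) : 0 < padeJ c i j := by
  unfold padeJ
  apply intervalIntegral.intervalIntegral_pos_of_pos_on (padeJ_integrable c h0 h1 i j) _ h1
  intro s hs
  have hs0 : 0 < s := lt_trans h0 hs.1
  have hX : 0 < 1 - s ^ 2 := by nlinarith [hs.2]
  have hY : 0 < 1 - c ^ 2 / s ^ 2 := by
    rw [sub_pos, div_lt_one (by positivity)]
    nlinarith [hs.1]
  positivity

lemma padeB_mono (z : ℝ) (h0 : 0 < z) (h1 : z < 1) (j : ℕ) :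
    ∀ i, 0 ≤ padeB z i j ∧ padeB z i j ≤ padeB z (i + 1) j := by
  induction j with
  | zero =>
    intro i
    cases i <;> simp [padeB]
  | succ j ih =>
    have hm : ∀ i, padeB z i (j + 1) ≤ padeB z (i + 1) (j + 1) := by
      intro i
      obtain ⟨ha, hb⟩ := ih i
      rw [padeB]
      nlinarith
    intro i
    refine ⟨?_, hm i⟩
    induction i with
    | zero =>
      have := (ih 0).1
      rw [padeB]
      positivity
    | succ i ihi => exact ihi.trans (hm i)

lemma padeB_le (z : ℝ) (h0 : 0 < z) (h1 : z < 1) (i j : ℕ) : padeB z i j ≤ 2 ^ (i + j + 1) := by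
  induction i generalizing j with
  | zero =>
    induction j with
    | zero => simp [padeB]
    | succ j ih =>
      rw [padeB]
      have h := padeW_le (j + 1)
      have h2 := padeW_pos (j + 1)
      have e : padeW (j + 1) * z ^ (j + 1)
          = (Nat.centralBinom (j + 1) : ℝ) * (z / 4) ^ (j + 1) := by
        unfold padeW
        rw [div_pow]
        ring
      rw [← e]
      have hz : z ^ (j + 1) ≤ 1 := pow_le_one₀ h0.le h1.le
      have hz0 : 0 ≤ z ^ (j + 1) := by positivity
      have : (1 : ℝ) ≤ 2 ^ (0 + j + 1) := one_le_pow₀ (by norm_num)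
      have e2 : (2 : ℝ) ^ (0 + (j + 1) + 1) = 2 * 2 ^ (0 + j + 1) := by ring
      rw [e2]
      nlinarith
  | succ i ihi =>
    induction j with
    | zero =>
      rw [padeB]
      exact one_le_pow₀ (by norm_num)
    | succ j ihj =>
      rw [padeB]
      have a := ihi (j + 1)
      have b := (padeB_mono z h0 h1 j i).1
      have e1 : (2 : ℝ) ^ (i + 1 + (j + 1) + 1) = 2 ^ (i + (j + 1) + 1) + 2 ^ (i + 1 + j + 1) := by
        ring
      rw [e1]
      nlinarith

lemma padeA_int (i j : ℕ) : ∃ p : ℤ, padeA (7 / 2 ^ 15) i j * 2 ^ (17 * i) = p := by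
  induction i generalizing j with
  | zero => exact ⟨1, by simp [padeA]⟩
  | succ i ihi =>
    induction j with
    | zero =>
      obtain ⟨p, hp⟩ := ihi 0
      refine ⟨p * 2 ^ 17 - 2 * catalan i * 7 ^ (i + 1), ?_⟩
      rw [padeA]
      push_cast
      rw [← hp]
      have : ((7 : ℝ) / 2 ^ 15 / 4) ^ (i + 1) * 2 ^ (17 * (i + 1)) = 7 ^ (i + 1) := by
        rw [pow_mul, ← mul_pow]
        norm_num
      rw [← this]
      ring
    | succ j ihj =>
      obtain ⟨p, hp⟩ := ihi (j + 1)
      obtain ⟨q, hq⟩ := ihj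
      obtain ⟨r, hr⟩ := ihi j
      refine ⟨p * 2 ^ 17 + q - 28 * r, ?_⟩
      rw [padeA]
      push_cast
      rw [← hp, ← hq, ← hr]
      ring

lemma padeB_int (i j : ℕ) : ∃ p : ℤ, padeB (7 / 2 ^ 15) i j * 2 ^ (17 * j) = p := by
  induction i generalizing j with
  | zero =>
    induction j with
    | zero => exact ⟨1, by simp [padeB]⟩
    | succ j ihj =>
      obtain ⟨p, hp⟩ := ihj
      refine ⟨p * 2 ^ 17 + Nat.centralBinom (j + 1) * 7 ^ (j + 1), ?_⟩
      rw [padeB]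
      push_cast
      rw [← hp]
      have : ((7 : ℝ) / 2 ^ 15 / 4) ^ (j + 1) * 2 ^ (17 * (j + 1)) = 7 ^ (j + 1) := by
        rw [pow_mul, ← mul_pow]
        norm_num
      rw [← this]
      ring
  | succ i ihi =>
    induction j with
    | zero => exact ⟨1, by simp [padeB]⟩
    | succ j ihj =>
      obtain ⟨p, hp⟩ := ihi (j + 1)
      obtain ⟨q, hq⟩ := ihj
      obtain ⟨r, hr⟩ := ihi j
      refine ⟨p + q * 2 ^ 17 - 28 * r, ?_⟩
      rw [padeB]
      push_cast
      rw [← hp, ← hq, ← hr]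
      ring

lemma pade_amgm (X Y : ℝ) (hX : 0 ≤ X) (hY : 0 ≤ Y) : 256 * (X * Y ^ 3) ≤ 27 * (X + Y) ^ 4 := by
  have : 27 * (X + Y) ^ 4 - 256 * (X * Y ^ 3)
      = (Y - 3 * X) ^ 2 * (27 * Y ^ 2 + 14 * (X * Y) + 3 * X ^ 2) := by ring
  have h2 : 0 ≤ (Y - 3 * X) ^ 2 * (27 * Y ^ 2 + 14 * (X * Y) + 3 * X ^ 2) := by positivity
  linarith

lemma padeJ_le (c : ℝ) (h0 : 0 < c) (h1 : c < 1) (hc : c ^ 2 = 1 - 7 / 2 ^ 15) (j : ℕ) :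
    padeJ c (3 * j) j ≤ (1 / 2 ^ 52) ^ j * (1 - c) := by
  unfold padeJ
  have h := intervalIntegral.norm_integral_le_of_norm_le_const (a := c) (b := 1)
    (f := fun s : ℝ => (1 - s ^ 2) ^ j * (1 - c ^ 2 / s ^ 2) ^ (3 * j))
    (C := (1 / 2 ^ 52) ^ j) ?_
  · rw [abs_of_pos (by linarith : 0 < 1 - c)] at h
    exact (le_abs_self _).trans h
  · intro s hs
    rw [Set.uIoc_of_le h1.le] at hs
    have hs0 : 0 < s := lt_trans h0 hs.1
    have hX : 0 ≤ 1 - s ^ 2 := by nlinarith [hs.2]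
    have hY : 0 ≤ 1 - c ^ 2 / s ^ 2 := by
      rw [sub_nonneg, div_le_one (by positivity)]
      nlinarith [hs.1]
    have key : (1 - s ^ 2) * (1 - c ^ 2 / s ^ 2)
        = (1 - s ^ 2) + (1 - c ^ 2 / s ^ 2) - (1 - c ^ 2) := by
      field_simp
      ring
    have hXz : 1 - s ^ 2 ≤ 7 / 2 ^ 15 := by
      nlinarith [hs.1]
    set X := 1 - s ^ 2
    set Y := 1 - c ^ 2 / s ^ 2
    have hYz : Y ≤ 7 / 2 ^ 15 := by
      rw [hc] at key
      nlinarith [mul_nonneg hX (by nlinarith : 0 ≤ 1 - Y)]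
    have hsum : X + Y ≤ 7 / 2 ^ 15 + (7 / 2 ^ 15) ^ 2 := by
      have : X * Y ≤ (7 / 2 ^ 15) * (7 / 2 ^ 15) := mul_le_mul hXz hYz hY (by norm_num)
      rw [hc] at key
      linarith
    have h4 : (X + Y) ^ 4 ≤ (7 / 2 ^ 15 + (7 / 2 ^ 15) ^ 2) ^ 4 :=
      pow_le_pow_left₀ (by positivity) hsum 4
    have hfin : X * Y ^ 3 ≤ 1 / 2 ^ 52 := by
      have := pade_amgm X Y hX hY
      norm_num at h4 ⊢
      linarith
    rw [Real.norm_of_nonneg (by positivity), pow_mul, ← mul_pow]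
    exact pow_le_pow_left₀ (by positivity) hfin j

set_option maxHeartbeats 1000000 in
lemma pade_bound (x D M j : ℕ) (hD : 0 < D) (h : x ^ 2 + D = 2 ^ (2 * M + 1))
    (hj : M + 8 ≤ 34 * j) : 2 ^ (2 * M + 1) ≤ D * 2 ^ (55 * j + 2) := by
  have ht2 : Real.sqrt 2 ^ 2 = 2 := Real.sq_sqrt (by norm_num)
  have htpos : 0 < Real.sqrt 2 := by positivity
  set t := Real.sqrt 2
  set c : ℝ := 181 / (128 * t) with hcdef
  have hc2 : c ^ 2 = 1 - 7 / 2 ^ 15 := by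
    rw [hcdef, div_pow, mul_pow, ht2]; norm_num
  have hc0 : 0 < c := by positivity
  have hc1 : c < 1 := by nlinarith
  have hc34 : 3 / 4 ≤ c := by nlinarith
  have hz : (1 : ℝ) - c ^ 2 = 7 / 2 ^ 15 := by rw [hc2]; ring
  have hid := pade_identity c hc0 hc1 (3 * j) j
  rw [hz] at hid
  have hJpos := padeJ_pos c hc0 hc1 (3 * j) j
  have hJle := padeJ_le c hc0 hc1 hc2 j
  have hB0 := (padeB_mono (7 / 2 ^ 15) (by norm_num) (by norm_num) j (3 * j)).1
  have hB1 := padeB_le (7 / 2 ^ 15) (by norm_num) (by norm_num) (3 * j) j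
  obtain ⟨p, hp⟩ := padeA_int (3 * j) j
  obtain ⟨q, hq⟩ := padeB_int (3 * j) j
  set A := padeA (7 / 2 ^ 15) (3 * j) j
  set B := padeB (7 / 2 ^ 15) (3 * j) j
  set R : ℝ := (2 * j + 1) * padeW j * padeW (3 * j) * padeJ c (3 * j) j with hR
  have hw1 := padeW_pos j
  have hw2 := padeW_pos (3 * j)
  have hw3 := padeW_le j
  have hw4 := padeW_le (3 * j)
  have hRpos : 0 < R := by positivity
  have h2j : (2 * (j : ℝ) + 1) ≤ 2 * 2 ^ j := by
    have : 2 * j + 1 ≤ 2 * 2 ^ j := by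
      have := Nat.lt_two_pow_self (n := j)
      omega
    exact_mod_cast this
  have hRle : R * 2 ^ (51 * j) ≤ 1 / 2 := by
    have s1 : R ≤ (2 * j + 1) * padeJ c (3 * j) j := by
      have : padeW j * padeW (3 * j) ≤ 1 := by nlinarith
      have h3 : 0 < (2 * (j : ℝ) + 1) * padeJ c (3 * j) j := by positivity
      rw [hR]
      nlinarith
    have s2 : R ≤ (2 * 2 ^ j) * ((1 / 2 ^ 52) ^ j * (1 / 4)) := by
      refine s1.trans (mul_le_mul h2j (hJle.trans ?_) hJpos.le (by positivity))
      apply mul_le_mul_of_nonneg_left (by linarith) (by positivity)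
    calc R * 2 ^ (51 * j) ≤ (2 * 2 ^ j) * ((1 / 2 ^ 52) ^ j * (1 / 4)) * 2 ^ (51 * j) := by gcongr
      _ = (2 * (1 / 2 ^ 52) * 2 ^ 51) ^ j * (1 / 2) := by
        rw [mul_pow, mul_pow, pow_mul]; ring
      _ = 1 / 2 := by norm_num
  have hNat : (x : ℝ) ^ 2 + D = 2 ^ (2 * M + 1) := by exact_mod_cast h
  have hDpos : (0 : ℝ) < D := by exact_mod_cast hD
  set u : ℝ := x / (2 ^ M * t) with hu
  have hu0 : 0 ≤ u := by positivity
  have hu2 : 1 - u ^ 2 = D / 2 ^ (2 * M + 1) := by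
    have e : ((2 : ℝ) ^ M * t) ^ 2 = 2 ^ (2 * M + 1) := by
      rw [mul_pow, ht2]; ring
    rw [hu, div_pow, e, ← hNat]
    have : (x : ℝ) ^ 2 + D ≠ 0 := by positivity
    field_simp
    ring
  have hDN : 0 < (D : ℝ) / 2 ^ (2 * M + 1) := by positivity
  have hu1 : u < 1 := by nlinarith
  have hcu : c * u = 181 * x / 2 ^ (M + 8) := by
    rw [hcdef, hu]
    field_simp
    rw [ht2]
    ring
  have hTint : (A - c * u * B) * 2 ^ (51 * j)
      = ((p - q * 181 * x * 2 ^ (34 * j - (M + 8)) : ℤ) : ℝ) := by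
    have e1 : (2 : ℝ) ^ (51 * j) = 2 ^ (M + 8) * 2 ^ (34 * j - (M + 8)) * 2 ^ (17 * j) := by
      rw [← pow_add, ← pow_add]; congr 1; omega
    have e2 : 17 * (3 * j) = 51 * j := by ring
    rw [e2] at hp
    push_cast
    rw [← hp, ← hq, hcu, sub_mul, e1]
    field_simp
  have hTpos : 0 < (A - c * u * B) * 2 ^ (51 * j) := by
    apply mul_pos _ (by positivity)
    have : 0 ≤ c * (1 - u) * B := by
      have : 0 ≤ 1 - u := by linarith
      positivity
    nlinarith
  have hT1 : 1 ≤ (A - c * u * B) * 2 ^ (51 * j) := by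
    rw [hTint] at hTpos ⊢
    have : (0 : ℤ) < (p - q * 181 * x * 2 ^ (34 * j - (M + 8))) := by exact_mod_cast hTpos
    exact_mod_cast this
  have hT2 : (A - c * u * B) = R + c * (1 - u) * B := by rw [hid]; ring
  have hle : c * (1 - u) * B ≤ (D / 2 ^ (2 * M + 1)) * 2 ^ (3 * j + j + 1) := by
    apply mul_le_mul _ hB1 hB0 hDN.le
    rw [← hu2]
    have i1 : c * (1 - u) ≤ 1 * (1 - u) :=
      mul_le_mul_of_nonneg_right hc1.le (by linarith)
    have i2 : 0 ≤ u * (1 - u) := mul_nonneg hu0 (by linarith)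
    linarith [i1, i2, (by ring : 1 - u ^ 2 = (1 - u) + u * (1 - u))]
  rw [hT2, add_mul] at hT1
  have h5 : (1 : ℝ) / 2 ≤ ((D : ℝ) / 2 ^ (2 * M + 1)) * 2 ^ (3 * j + j + 1) * 2 ^ (51 * j) := by
    have : c * (1 - u) * B * 2 ^ (51 * j) ≤
      (D / 2 ^ (2 * M + 1)) * 2 ^ (3 * j + j + 1) * (2 : ℝ) ^ (51 * j) := by gcongr
    linarith
  have h6 : (2 : ℝ) ^ (2 * M + 1) ≤ D * 2 ^ (55 * j + 2) := by
    have e : (D : ℝ) * 2 ^ (55 * j + 2)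
        = (D / 2 ^ (2 * M + 1)) * 2 ^ (3 * j + j + 1) * 2 ^ (51 * j) * 2 * 2 ^ (2 * M + 1) := by
      field_simp
      ring
    rw [e]
    have : (0 : ℝ) < 2 ^ (2 * M + 1) := by positivity
    nlinarith
  exact_mod_cast h6


/-! ## Part 2: Lucas sequences and the structure of all solutions -/

/-- Lucas sequence of the first kind. -/
def lucU (a Q : ℤ) : ℕ → ℤ
  | 0 => 0
  | 1 => 1
  | n + 2 => a * lucU a Q (n + 1) - Q * lucU a Q n

/-- Lucas sequence of the second kind. -/
def lucV (a Q : ℤ) : ℕ → ℤ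
  | 0 => 2
  | 1 => a
  | n + 2 => a * lucV a Q (n + 1) - Q * lucV a Q n

lemma lucU_succ (a Q : ℤ) (k : ℕ) :
    lucU a Q (k + 1 + 1) = a * lucU a Q (k + 1) - Q * lucU a Q k := by rw [lucU]

lemma lucV_succ (a Q : ℤ) (k : ℕ) :
    lucV a Q (k + 1 + 1) = a * lucV a Q (k + 1) - Q * lucV a Q k := by rw [lucV]

lemma luc_rel1 (a Q : ℤ) (k : ℕ) : 2 * lucU a Q (k + 1) = lucV a Q k + a * lucU a Q k := by
  induction k using Nat.twoStepInduction with
  | zero => simp [lucU, lucV]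
  | one => simp [lucU, lucV]; ring
  | more k h1 h2 =>
    have e1 := lucU_succ a Q (k + 1)
    have e2 := lucV_succ a Q k
    have e3 := lucU_succ a Q k
    linear_combination 2 * e1 - e2 - a * e3 + a * h2 - Q * h1

lemma luc_rel2 (a Q : ℤ) (k : ℕ) :
    2 * lucV a Q (k + 1) = a * lucV a Q k - (4 * Q - a ^ 2) * lucU a Q k := by
  induction k using Nat.twoStepInduction with
  | zero => simp [lucU, lucV]; ring
  | one => simp [lucU, lucV]; ring
  | more k h1 h2 =>
    have e1 := lucV_succ a Q (k + 1)
    have e2 := lucV_succ a Q k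
    have e3 := lucU_succ a Q k
    linear_combination 2 * e1 - a * e2 + (4 * Q - a ^ 2) * e3 + a * h2 - Q * h1

lemma luc_rel3 (a Q : ℤ) (k : ℕ) :
    lucV a Q (k + 1) - a * lucU a Q (k + 1) = -(2 * Q * lucU a Q k) := by
  induction k using Nat.twoStepInduction with
  | zero => simp [lucU, lucV]
  | one => simp [lucU, lucV]; ring
  | more k h1 h2 =>
    have e1 := lucV_succ a Q (k + 1)
    have e2 := lucU_succ a Q (k + 1)
    have e3 := lucU_succ a Q k
    linear_combination e1 - a * e2 + 2 * Q * e3 + a * h2 - Q * h1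

lemma odd_pair_dvd (p q : ℤ) (m : ℕ) (hp : Odd p) (hq : Odd q)
    (h : (2 : ℤ) ^ (m + 2) ∣ (p - q) * (p + q)) :
    (2 : ℤ) ^ (m + 1) ∣ p - q ∨ (2 : ℤ) ^ (m + 1) ∣ p + q := by
  obtain ⟨s, hs⟩ := hp
  obtain ⟨t, ht⟩ := hq
  have e1 : p - q = 2 * (s - t) := by rw [hs, ht]; ring
  have e2 : p + q = 2 * (s + t + 1) := by rw [hs, ht]; ring
  rw [e1, e2] at h ⊢
  have h' : (2 : ℤ) ^ m ∣ (s - t) * (s + t + 1) := by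
    have e3 : (2 : ℤ) ^ (m + 2) = 4 * 2 ^ m := by ring
    have e4 : 2 * (s - t) * (2 * (s + t + 1)) = 4 * ((s - t) * (s + t + 1)) := by ring
    rw [e3, e4] at h
    exact Int.dvd_of_mul_dvd_mul_left (by norm_num) h
  have e5 : (2 : ℤ) ^ (m + 1) = 2 * 2 ^ m := by ring
  rw [e5]
  rcases Int.even_or_odd (s - t) with hst | hst
  · left
    apply mul_dvd_mul_left
    have : IsCoprime ((2 : ℤ) ^ m) (s + t + 1) := by
      apply IsCoprime.pow_left
      rw [Int.isCoprime_iff_gcd_eq_one]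
      have : Odd (s + t + 1) := by
        obtain ⟨r, hr⟩ := hst
        exact ⟨r + t, by linarith⟩
      have := this.natAbs
      simpa [Int.gcd] using (Nat.coprime_two_left.mpr this)
    exact this.dvd_of_dvd_mul_right h'
  · right
    apply mul_dvd_mul_left
    have : IsCoprime ((2 : ℤ) ^ m) (s - t) := by
      apply IsCoprime.pow_left
      rw [Int.isCoprime_iff_gcd_eq_one]
      have := hst.natAbs
      simpa [Int.gcd] using (Nat.coprime_two_left.mpr this)
    exact this.dvd_of_dvd_mul_left h'

lemma rep_struct (D a b : ℤ) (m : ℕ) (hD : 4 < D) (hDo : Odd D) (hm : 1 ≤ m) (ha : Odd a) (hb : Odd b)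
    (hab : a ^ 2 + D * b ^ 2 = 2 ^ (m + 2))
    (hmin : ∀ r : ℕ, 1 ≤ r → ∀ u w : ℤ, Odd u → Odd w → u ^ 2 + D * w ^ 2 = 2 ^ (r + 2) → m ≤ r) :
    ∀ r : ℕ, 1 ≤ r → ∀ u w : ℤ, Odd u → Odd w → u ^ 2 + D * w ^ 2 = 2 ^ (r + 2) →
      ∃ k : ℕ, 1 ≤ k ∧ r = m * k ∧ (u = lucV a (2 ^ m) k ∨ u = -lucV a (2 ^ m) k) ∧
        (w = b * lucU a (2 ^ m) k ∨ w = -(b * lucU a (2 ^ m) k)) := by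
  intro r
  induction r using Nat.strong_induction_on with
  | _ r ih =>
  intro hr u w hu hw huw
  -- reduce to the case of a good sign
  suffices H : ∀ w : ℤ, Odd w → u ^ 2 + D * w ^ 2 = 2 ^ (r + 2) →
      (2 : ℤ) ^ (m + 1) ∣ u * b - w * a →
      ∃ k : ℕ, 1 ≤ k ∧ r = m * k ∧ (u = lucV a (2 ^ m) k ∨ u = -lucV a (2 ^ m) k) ∧
        (w = b * lucU a (2 ^ m) k ∨ w = -(b * lucU a (2 ^ m) k)) by
    have hmr := hmin r hr u w hu hw huw
    have hdvd : (2 : ℤ) ^ (m + 2) ∣ (u * b - w * a) * (u * b + w * a) := by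
      have e : (u * b - w * a) * (u * b + w * a) = b ^ 2 * 2 ^ (r + 2) - w ^ 2 * 2 ^ (m + 2) := by
        rw [← huw, ← hab]; ring
      rw [e]
      apply dvd_sub
      · exact Dvd.dvd.mul_left (pow_dvd_pow 2 (by omega)) _
      · exact Dvd.intro_left _ rfl
    rcases odd_pair_dvd _ _ m (hu.mul hb) (hw.mul ha) hdvd with h | h
    · exact H w hw huw h
    · obtain ⟨k, h1, h2, h3, h4⟩ := H (-w) hw.neg (by rw [neg_sq]; exact huw)
        (by rw [neg_mul, sub_neg_eq_add]; exact h)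
      refine ⟨k, h1, h2, h3, ?_⟩
      rcases h4 with h4 | h4
      · right; linarith
      · left; linarith
  clear huw hw w
  intro w hw huw hdvd
  have hmr := hmin r hr u w hu hw huw
  obtain ⟨w1, hw1⟩ := hdvd
  have hu1 : (2 : ℤ) ^ (m + 1) ∣ u * a + D * w * b := by
    have hcop : IsCoprime ((2 : ℤ) ^ (m + 1)) a := by
      apply IsCoprime.pow_left
      rw [Int.isCoprime_iff_gcd_eq_one]
      have := ha.natAbs
      simpa [Int.gcd] using (Nat.coprime_two_left.mpr this)
    apply hcop.dvd_of_dvd_mul_left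
    refine ⟨2 * u - D * b * w1, ?_⟩
    have : (2 : ℤ) ^ (m + 2) = 2 * 2 ^ (m + 1) := by ring
    rw [this] at hab
    linear_combination u * hab - D * b * hw1
  obtain ⟨u1, hu1⟩ := hu1
  have hpos : (2 : ℤ) ^ (m + 1) ≠ 0 := by positivity
  have hab' : a ^ 2 + D * b ^ 2 = 2 * 2 ^ (m + 1) := by rw [hab]; ring
  -- inverse formulas, with w1 replaced by its negative
  have eu : 2 * u = u1 * a + D * w1 * b := by
    apply mul_left_cancel₀ hpos
    linear_combination -u * hab' + a * hu1 + D * b * hw1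
  have ew : 2 * w = u1 * b - w1 * a := by
    apply mul_left_cancel₀ hpos
    linear_combination -w * hab' + b * hu1 - a * hw1
  have hnorm : u1 ^ 2 + D * w1 ^ 2 = 2 ^ (r - m + 2) := by
    have e : (2 : ℤ) ^ (r + 2) = 2 ^ (r - m + 2) * 2 ^ m := by
      rw [← pow_add]; congr 1; omega
    have hpos' : (2 : ℤ) ^ (m + 2) ≠ 0 := by positivity
    apply mul_left_cancel₀ hpos'
    rw [← hab]
    have e2 : (a ^ 2 + D * b ^ 2) * 2 ^ (r - m + 2) = 4 * (2 ^ (r - m + 2) * 2 ^ m) := by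
      rw [hab]; ring
    rw [e2, ← e, ← huw]
    linear_combination -(2 * u + u1 * a + D * w1 * b) * eu - D * (2 * w + u1 * b - w1 * a) * ew
  have hQ : a ^ 2 + D * b ^ 2 = 4 * 2 ^ m := by rw [hab]; ring
  rcases Nat.eq_or_lt_of_le hmr with hEq | hLt
  · -- r = m
    subst hEq
    have hn4 : u1 ^ 2 + D * w1 ^ 2 = 4 := by simpa using hnorm
    have hw10 : w1 = 0 := by
      by_contra hne
      have : 1 ≤ w1 ^ 2 := by
        have := sq_nonneg w1
        have h2 : w1 ^ 2 ≠ 0 := pow_ne_zero 2 hne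
        omega
      nlinarith [sq_nonneg u1]
    subst hw10
    have hu2 : u1 = 2 ∨ u1 = -2 := by
      have : u1 ^ 2 = 2 ^ 2 := by linarith
      exact sq_eq_sq_iff_eq_or_eq_neg.mp this
    refine ⟨1, le_refl _, by ring, ?_, ?_⟩
    · simp only [lucV]
      rcases hu2 with h | h <;> subst h
      · left; linarith
      · right; linarith
    · simp only [lucU]
      rcases hu2 with h | h <;> subst h
      · left; linarith
      · right; linarith
  · have hrm : 1 ≤ r - m := by omega
    have hpar : Odd u1 ∧ Odd w1 := by
      have hev : Even (u1 ^ 2 + D * w1 ^ 2) := by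
        rw [hnorm]; exact (even_two).pow_of_ne_zero (by omega)
      have hbad : ¬ (Even u1 ∧ Even w1) := by
        rintro ⟨⟨u', hu'⟩, ⟨w', hw'⟩⟩
        have e : u' ^ 2 + D * w' ^ 2 = 2 ^ (r - m) := by
          have : (2 : ℤ) ^ (r - m + 2) = 4 * 2 ^ (r - m) := by ring
          rw [this, hu', hw'] at hnorm
          linarith
        have hev2 : Even (u' ^ 2 + D * w' ^ 2) := by
          rw [e]; exact (even_two).pow_of_ne_zero (by omega)
        have ew' : w = u' * b - w' * a := by
          rw [hu', hw'] at ew; linarith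
        have hw2 : Even w := by
          rw [ew']
          simp only [Int.even_add, Int.even_sub, Int.even_mul, Int.even_pow] at hev2 ⊢
          simp only [← Int.not_odd_iff_even] at hev2 ⊢
          tauto
        exact (Int.not_odd_iff_even.mpr hw2) hw
      simp only [Int.even_add, Int.even_mul, Int.even_pow] at hev
      simp only [← Int.not_odd_iff_even] at hev hbad
      tauto
    obtain ⟨k, hk1, hk2, hk3, hk4⟩ := ih (r - m) (by omega) hrm u1 w1 hpar.1 hpar.2 hnorm
    have r1 := luc_rel1 a (2 ^ m) k
    have r2 := luc_rel2 a (2 ^ m) k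
    obtain ⟨k', rfl⟩ : ∃ k', k = k' + 1 := ⟨k - 1, by omega⟩
    have r3 := luc_rel3 a (2 ^ m) k'
    set V := lucV a (2 ^ m) (k' + 1)
    set U := lucU a (2 ^ m) (k' + 1)
    have hmm : r = m * (k' + 1 + 1) := by
      rw [Nat.mul_add, ← hk2]; omega
    have hDb : 4 * 2 ^ m - a ^ 2 = D * b ^ 2 := by linarith
    rw [hDb] at r2
    have hbadw : ∀ t : ℤ, w ≠ 2 ^ m * t := by
      intro t ht
      have : Even w := by
        rw [ht]
        exact ((even_two).pow_of_ne_zero (by omega)).mul_right _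
      exact (Int.not_odd_iff_even.mpr this) hw
    refine ⟨k' + 1 + 1, by omega, hmm, ?_⟩
    rcases hk3 with h3 | h3 <;> rcases hk4 with h4 | h4
    · exfalso
      apply hbadw (-(b * lucU a (2 ^ m) k'))
      rw [h3, h4] at ew
      have : 2 * w = 2 * (2 ^ m * (-(b * lucU a (2 ^ m) k'))) := by
        linear_combination ew + b * r3
      linarith
    · constructor
      · left
        rw [h3, h4] at eu
        linarith [eu, r2]
      · left
        rw [h3, h4] at ew
        have : 2 * w = 2 * (b * lucU a (2 ^ m) (k' + 1 + 1)) := by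
          linear_combination ew - b * r1
        linarith
    · constructor
      · right
        rw [h3, h4] at eu
        linarith [eu, r2]
      · right
        rw [h3, h4] at ew
        have : 2 * w = -2 * (b * lucU a (2 ^ m) (k' + 1 + 1)) := by
          linear_combination ew + b * r1
        linarith
    · exfalso
      apply hbadw ((b * lucU a (2 ^ m) k'))
      rw [h3, h4] at ew
      have : 2 * w = 2 * (2 ^ m * (b * lucU a (2 ^ m) k')) := by
        linear_combination ew - b * r3
      linarith

lemma sol_odd (D z n : ℕ) (hD : Odd D) (hn : 1 ≤ n) (h : z ^ 2 + D = 2 ^ n) : Odd z := by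
  have : Even (z ^ 2 + D) := by
    rw [h]; exact even_two.pow_of_ne_zero (by omega)
  by_contra hz
  rw [Nat.not_odd_iff_even] at hz
  have h2 : Even (z ^ 2) := hz.pow_of_ne_zero (by norm_num)
  rw [Nat.even_add] at this
  exact (Nat.not_even_iff_odd.mpr hD) (this.mp h2)

lemma sol_struct (D : ℕ) (hD : 4 < D) (hDo : Odd D) (z0 n0 : ℕ) (h0 : z0 ^ 2 + D = 2 ^ n0) :
    ∃ m a : ℕ, 1 ≤ m ∧ Odd a ∧ a ^ 2 + D = 2 ^ (m + 2) ∧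
      ∀ z n : ℕ, z ^ 2 + D = 2 ^ n → ∃ k : ℕ, 1 ≤ k ∧ n = m * k + 2 ∧
        (lucU a (2 ^ m) k = 1 ∨ lucU a (2 ^ m) k = -1) := by
  have hn3 : ∀ z n : ℕ, z ^ 2 + D = 2 ^ n → 3 ≤ n := by
    intro z n h
    by_contra hc
    have : 2 ^ n ≤ 2 ^ 2 := Nat.pow_le_pow_right (by norm_num) (by omega)
    nlinarith [sq_nonneg z]
  have hrep : ∀ z n : ℕ, z ^ 2 + D = 2 ^ n →
      (z : ℤ) ^ 2 + (D : ℤ) * 1 ^ 2 = 2 ^ (n - 2 + 2) := by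
    intro z n h
    have h3 := hn3 z n h
    have : n - 2 + 2 = n := by omega
    rw [this]
    push_cast
    have : ((z ^ 2 + D : ℕ) : ℤ) = ((2 ^ n : ℕ) : ℤ) := by rw [h]
    push_cast at this
    linarith
  have hzo : ∀ z n : ℕ, z ^ 2 + D = 2 ^ n → Odd (z : ℤ) := by
    intro z n h
    have h3 := hn3 z n h
    exact_mod_cast sol_odd D z n hDo (by omega) h
  have hex : ∃ r : ℕ, 1 ≤ r ∧ ∃ u w : ℤ, Odd u ∧ Odd w ∧ u ^ 2 + (D : ℤ) * w ^ 2 = 2 ^ (r + 2) := by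
    have h3 := hn3 z0 n0 h0
    exact ⟨n0 - 2, by omega, z0, 1, hzo z0 n0 h0, odd_one, hrep z0 n0 h0⟩
  classical
  obtain ⟨hm, a, b, ha, hb, hab⟩ := Nat.find_spec hex
  have hmin := fun r => Nat.find_min' hex (m := r)
  set m := Nat.find hex
  -- normalise a to be nonnegative
  have ha' : Odd (a.natAbs : ℤ) := by exact_mod_cast ha.natAbs
  have hab' : (a.natAbs : ℤ) ^ 2 + (D : ℤ) * b ^ 2 = 2 ^ (m + 2) := by
    rw [Int.natAbs_sq]; exact hab
  have hs := rep_struct D a.natAbs b m (by exact_mod_cast hD) (by exact_mod_cast hDo) hm ha' hb hab'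
    (fun r hr u w hu hw h => hmin r ⟨hr, u, w, hu, hw, h⟩)
  have hunit : ∀ z n : ℕ, z ^ 2 + D = 2 ^ n → ∃ k : ℕ, 1 ≤ k ∧ n = m * k + 2 ∧
        (b * lucU a.natAbs (2 ^ m) k = 1 ∨ b * lucU a.natAbs (2 ^ m) k = -1) := by
    intro z n h
    have h3 := hn3 z n h
    obtain ⟨k, hk, hk2, -, hk4⟩ := hs (n - 2) (by omega) z 1 (hzo z n h) odd_one (hrep z n h)
    refine ⟨k, hk, by omega, ?_⟩
    rcases hk4 with h | h
    · left; linarith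
    · right; linarith
  have hb1 : b = 1 ∨ b = -1 := by
    obtain ⟨k, -, -, h⟩ := hunit z0 n0 h0
    have : IsUnit b := by
      rcases h with h | h
      · exact IsUnit.of_mul_eq_one _ h
      · exact IsUnit.of_mul_eq_one (-lucU a.natAbs (2 ^ m) k) (by linarith)
    exact Int.isUnit_iff.mp this
  refine ⟨m, a.natAbs, hm, ha.natAbs, ?_, ?_⟩
  · have : b ^ 2 = 1 := by rcases hb1 with h | h <;> rw [h] <;> norm_num
    rw [this, mul_one] at hab'
    exact_mod_cast hab'
  · intro z n h
    obtain ⟨k, hk, hk2, hk3⟩ := hunit z n h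
    refine ⟨k, hk, hk2, ?_⟩
    rcases hb1 with h | h <;> rw [h] at hk3
    · simpa using hk3
    · rcases hk3 with h | h
      · right; linarith
      · left; linarith


/-! ## Part 3: congruences, bounds and the final argument -/

lemma lucU_even_dvd (a Q : ℤ) (j : ℕ) : a ∣ lucU a Q (2 * j) := by
  induction j with
  | zero => simp [lucU]
  | succ j ih =>
    have e : lucU a Q (2 * (j + 1)) = a * lucU a Q (2 * j + 1) - Q * lucU a Q (2 * j) :=
      lucU_succ a Q (2 * j)
    rw [e]
    exact dvd_sub (Dvd.intro _ rfl) (Dvd.dvd.mul_left ih _)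

lemma lucU_congr (a Q : ℤ) (ha : Odd a) (hQ : Even Q) (j : ℕ) :
    (∃ s, lucU a Q (2 * j + 2) = a ^ (2 * j + 1) + 2 * Q * s) ∧
    (∃ t, lucU a Q (2 * j + 3) = a ^ (2 * j + 2) + Q + 2 * Q * t) := by
  induction j with
  | zero =>
    refine ⟨⟨0, by simp [lucU]⟩, ⟨-1, ?_⟩⟩
    simp [lucU]
    ring
  | succ j ih =>
    obtain ⟨⟨s, hs⟩, ⟨t, ht⟩⟩ := ih
    have e1 : lucU a Q (2 * j + 4) = a * lucU a Q (2 * j + 3) - Q * lucU a Q (2 * j + 2) :=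
      lucU_succ a Q (2 * j + 2)
    have e2 : lucU a Q (2 * j + 5) = a * lucU a Q (2 * j + 4) - Q * lucU a Q (2 * j + 3) :=
      lucU_succ a Q (2 * j + 3)
    have i1 : 2 * (j + 1) + 2 = 2 * j + 4 := by ring
    have i2 : 2 * (j + 1) + 3 = 2 * j + 5 := by ring
    rw [i1, i2]
    obtain ⟨p, hp⟩ : Even (a - a ^ (2 * j + 1)) := ha.sub_odd ha.pow
    obtain ⟨q, hq⟩ : Even (-1 - a ^ (2 * j + 2) - Q) := by
      apply Even.sub _ hQ
      exact Odd.sub_odd (by decide) ha.pow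
    have h4 : lucU a Q (2 * j + 4) = a ^ (2 * (j + 1) + 1) + 2 * Q * (p + a * t - Q * s) := by
      rw [e1, hs, ht]
      linear_combination Q * hp
    refine ⟨⟨_, h4⟩, ⟨q + a * (p + a * t - Q * s) - Q * t, ?_⟩⟩
    rw [e2, h4, ht]
    linear_combination Q * hq

lemma val_bound (a e m : ℕ) (ha : Odd a) (ha1 : 1 < a) (he : e ≠ 0) (hev : Even e)
    (h : 2 ^ m ∣ a ^ e - 1) : 2 ^ m ≤ e * (a + 1) := by
  obtain ⟨s, hs⟩ := ha
  have hs1 : 1 ≤ s := by omega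
  have hv := padicValNat.pow_two_sub_pow (x := a) (y := 1) ha1 (by omega) (by omega) he hev
  rw [one_pow] at hv
  have hne : a ^ e - 1 ≠ 0 := by
    have := Nat.one_lt_pow he ha1
    omega
  have hm : m ≤ padicValNat 2 (a ^ e - 1) := (padicValNat_dvd_iff_le hne).mp h
  have h1 : 2 ^ padicValNat 2 (a + 1) ∣ a + 1 := pow_padicValNat_dvd
  have h2 : 2 ^ padicValNat 2 (a - 1) ∣ a - 1 := pow_padicValNat_dvd
  have h3 : 2 ^ padicValNat 2 e ∣ e := pow_padicValNat_dvd
  have h1' := Nat.le_of_dvd (by omega) h1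
  have h2' := Nat.le_of_dvd (by omega) h2
  have h3' := Nat.le_of_dvd (by omega) h3
  have hone : padicValNat 2 (a + 1) ≤ 1 ∨ padicValNat 2 (a - 1) ≤ 1 := by
    by_contra hc
    push Not at hc
    have d1 : 2 ^ 2 ∣ a + 1 := (pow_dvd_pow 2 (by omega)).trans h1
    have d2 : 2 ^ 2 ∣ a - 1 := (pow_dvd_pow 2 (by omega)).trans h2
    omega
  rcases hone with h | h
  · calc 2 ^ m ≤ 2 ^ (padicValNat 2 e + padicValNat 2 (a - 1)) :=
          Nat.pow_le_pow_right (by norm_num) (by omega)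
      _ = 2 ^ padicValNat 2 e * 2 ^ padicValNat 2 (a - 1) := pow_add _ _ _
      _ ≤ e * (a + 1) := Nat.mul_le_mul h3' (by omega)
  · calc 2 ^ m ≤ 2 ^ (padicValNat 2 e + padicValNat 2 (a + 1)) :=
          Nat.pow_le_pow_right (by norm_num) (by omega)
      _ = 2 ^ padicValNat 2 e * 2 ^ padicValNat 2 (a + 1) := pow_add _ _ _
      _ ≤ e * (a + 1) := Nat.mul_le_mul h3' (by omega)

/-- If `a = 1`, no odd index `≥ 3` gives `±1`. -/
lemma lucU_one_odd (m j : ℕ) (hm : 2 ≤ m)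
    (h : lucU 1 (2 ^ m) (2 * j + 3) = 1 ∨ lucU 1 (2 ^ m) (2 * j + 3) = -1) : False := by
  obtain ⟨-, t, ht⟩ := lucU_congr 1 (2 ^ m) odd_one (even_two.pow_of_ne_zero (by omega)) j
  rw [ht, one_pow] at h
  obtain ⟨i, rfl⟩ : ∃ i, m = i + 2 := ⟨m - 2, by omega⟩
  have e : (2 : ℤ) ^ (i + 2) = 4 * 2 ^ i := by ring
  rw [e] at h
  have hpos : (0 : ℤ) < 2 ^ i := by positivity
  rcases h with h | h
  · have : (2 : ℤ) ^ i * (1 + 2 * t) = 0 := by linarith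
    rcases mul_eq_zero.mp this with h | h <;> omega
  · have h2 : 2 * (2 ^ i * (1 + 2 * t)) = (-1 : ℤ) := by linarith
    omega

lemma lucU_odd_bound (a m j : ℕ) (ha : Odd a) (hm : 3 ≤ m)
    (h : lucU a (2 ^ m) (2 * j + 3) = 1 ∨ lucU a (2 ^ m) (2 * j + 3) = -1) :
    1 < a ∧ 2 ^ m ≤ (2 * j + 2) * (a + 1) := by
  have ha1 : 1 < a := by
    rcases Nat.lt_or_ge 1 a with h1 | h1
    · exact h1
    · exfalso
      have : a = 1 := by
        obtain ⟨s, hs⟩ := ha; omega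
      subst this
      exact lucU_one_odd m j (by omega) (by exact_mod_cast h)
  refine ⟨ha1, val_bound a (2 * j + 2) m ha ha1 (by omega) ⟨j + 1, by ring⟩ ?_⟩
  have haZ : Odd (a : ℤ) := by exact_mod_cast ha
  obtain ⟨-, t, ht⟩ := lucU_congr a (2 ^ m) haZ (even_two.pow_of_ne_zero (by omega)) j
  rw [ht] at h
  have hZ : (2 : ℤ) ^ m ∣ (a : ℤ) ^ (2 * j + 2) - 1 := by
    rcases h with h | h
    · exact ⟨-1 - 2 * t, by linarith⟩
    · exfalso
      have h8 : (8 : ℤ) ∣ (a : ℤ) ^ (2 * j + 2) - 1 := by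
        have h1 : (8 : ℤ) ∣ (a : ℤ) ^ 2 - 1 := Int.eight_dvd_sq_sub_one_of_odd haZ
        have h2 : (a : ℤ) ^ 2 - 1 ∣ ((a : ℤ) ^ 2) ^ (j + 1) - 1 := by
          simpa using sub_dvd_pow_sub_pow ((a : ℤ) ^ 2) 1 (j + 1)
        rw [← pow_mul] at h2
        exact h1.trans h2
      obtain ⟨i, rfl⟩ : ∃ i, m = i + 3 := ⟨m - 3, by omega⟩
      have e : (2 : ℤ) ^ (i + 3) = 8 * 2 ^ i := by ring
      rw [e] at h
      have h9 : (a : ℤ) ^ (2 * j + 2) - 1 = -2 - 8 * (2 ^ i * (1 + 2 * t)) := by linarith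
      rw [h9] at h8
      omega
  have : 1 ≤ a ^ (2 * j + 2) := Nat.one_le_pow _ _ (by omega)
  zify [this]
  exact hZ

/-- The integer square root of `2^617`, that is, the first binary digits of `√2`. -/
def sqrtTwoDigits : ℕ :=
  737485799622182222976626838696314256962313789093274008717518420350546954455594411854462932756

/-- Checks that `2^(2M+1)` is not close to a square, for all `M` with `9 ≤ M < 9 + f`. -/
def sqCheck : ℕ → Bool
  | 0 => true
  | f + 1 => Nat.ble (2 ^ ((2 * (9 + f) - 1) / 5 + 2) +
        (sqrtTwoDigits / 2 ^ (299 - f)) * (sqrtTwoDigits / 2 ^ (299 - f))) (2 ^ (2 * (9 + f) + 1)) &&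
      Nat.ble (2 ^ (2 * (9 + f) + 1) + 1)
        ((sqrtTwoDigits / 2 ^ (299 - f) + 1) * (sqrtTwoDigits / 2 ^ (299 - f) + 1)) && sqCheck f

lemma sqCheck_spec (f : ℕ) (h : sqCheck f = true) (i : ℕ) (hi : i < f) :
    ∃ s, 2 ^ ((2 * (9 + i) - 1) / 5 + 2) + s * s ≤ 2 ^ (2 * (9 + i) + 1) ∧
      2 ^ (2 * (9 + i) + 1) < (s + 1) * (s + 1) := by
  induction f with
  | zero => omega
  | succ f ih =>
    rw [sqCheck, Bool.and_eq_true, Bool.and_eq_true] at h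
    obtain ⟨⟨h1, h2⟩, h3⟩ := h
    rcases Nat.lt_or_ge i f with hlt | hge
    · exact ih h3 hlt
    · obtain rfl : i = f := by omega
      exact ⟨_, Nat.le_of_ble_eq_true h1, Nat.le_of_ble_eq_true h2⟩

lemma sq_gap (M z D : ℕ) (h9 : 9 ≤ M) (hM : M < 309) (h : z ^ 2 + D = 2 ^ (2 * M + 1)) :
    2 ^ ((2 * M - 1) / 5 + 2) ≤ D := by
  have hc : sqCheck 300 = true := by decide +kernel
  obtain ⟨s, h1, h2⟩ := sqCheck_spec 300 hc (M - 9) (by omega)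
  have e : 9 + (M - 9) = M := by omega
  rw [e] at h1 h2
  have hz : z < s + 1 := by
    by_contra hcon
    push Not at hcon
    have := Nat.mul_le_mul hcon hcon
    have e2 : z ^ 2 = z * z := sq z
    omega
  have : z * z ≤ s * s := Nat.mul_le_mul (by omega) (by omega)
  have e2 : z ^ 2 = z * z := sq z
  omega

lemma even_exp_bound (z D h : ℕ) (hD : 0 < D) (heq : z ^ 2 + D = 2 ^ (2 * h)) : 2 ^ h < D + 1 := by
  have e : (2 : ℕ) ^ (2 * h) = 2 ^ h * 2 ^ h := by rw [two_mul, pow_add]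
  rw [e] at heq
  have hz : z + 1 ≤ 2 ^ h := by
    by_contra hc
    push Not at hc
    have h2 : 2 ^ h ≤ z := by omega
    have h3 := Nat.mul_le_mul h2 h2
    have e2 : z ^ 2 = z * z := sq z
    rw [e2] at heq
    linarith
  have := Nat.mul_le_mul hz hz
  have : 1 ≤ 2 ^ h := Nat.one_le_two_pow
  nlinarith

set_option maxRecDepth 4000 in
lemma no_large_odd (D m a z j : ℕ) (hD : 0 < D) (hm : 3 ≤ m) (ha : Odd a)
    (hab : a ^ 2 + D = 2 ^ (m + 2)) (hz : Odd z)
    (heq : z ^ 2 + D = 2 ^ (m * (2 * j + 5) + 2))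
    (hU : lucU a (2 ^ m) (2 * j + 5) = 1 ∨ lucU a (2 ^ m) (2 * j + 5) = -1) : False := by
  obtain ⟨ha1, hval⟩ := lucU_odd_bound a m (j + 1) ha hm hU
  have hDlt : D < 2 ^ (m + 2) := by
    have : 0 < a ^ 2 := by positivity
    omega
  rcases Nat.even_or_odd m with ⟨l, hl⟩ | ⟨l, hl⟩
  · have e : m * (2 * j + 5) + 2 = 2 * (l * (2 * j + 5) + 1) := by rw [hl]; ring
    rw [e] at heq
    have h1 := even_exp_bound z D _ hD heq
    have h2 : 2 ^ (m + 2) ≤ 2 ^ (l * (2 * j + 5) + 1) := by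
      apply Nat.pow_le_pow_right (by norm_num)
      nlinarith
    omega
  · obtain ⟨M, hM⟩ : ∃ M, m * (2 * j + 5) + 2 = 2 * M + 1 := by
      refine ⟨l * (2 * j + 5) + j + 3, ?_⟩
      rw [hl]; ring
    rw [hM] at heq
    have h5m : 5 * m ≤ m * (2 * j + 5) := by nlinarith
    rcases Nat.lt_or_ge M 309 with hlt | hge
    · rcases Nat.lt_or_ge M 9 with h9 | h9
      · have hm3 : m = 3 := by omega
        subst hm3
        have hM8 : M = 8 := by omega
        subst hM8
        norm_num at heq hDlt
        have hz1 : z < 363 := by nlinarith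
        have hz2 : z ≠ 362 := by
          rintro rfl
          exact absurd hz (by decide)
        have : z ≤ 361 := by omega
        nlinarith
      · have h1 := sq_gap M z D h9 hlt heq
        have h2 : 2 ^ (m + 2) ≤ 2 ^ ((2 * M - 1) / 5 + 2) := by
          apply Nat.pow_le_pow_right (by norm_num)
          omega
        omega
    · obtain ⟨i, hi1, hi2⟩ : ∃ i, M + 8 ≤ 34 * i ∧ 34 * i ≤ M + 41 :=
        ⟨(M + 41) / 34, by omega, by omega⟩
      have hp := pade_bound z D M i hD heq hi1
      have hlt2 : 2 ^ (2 * M + 1) < 2 ^ (m + 2 + (55 * i + 2)) := by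
        rw [pow_add 2 (m + 2)]
        refine lt_of_le_of_lt hp ?_
        exact Nat.mul_lt_mul_of_pos_right hDlt (by positivity)
      have hexp := (Nat.pow_lt_pow_iff_right (by norm_num : 1 < 2)).mp hlt2
      have hm46 : 46 ≤ m := by omega
      have hj : 2 * j + 5 ≤ 13 := by
        by_contra hc
        push Not at hc
        have : m * 14 ≤ m * (2 * j + 5) := Nat.mul_le_mul_left m (by omega)
        omega
      have hmid : 2 ^ m ≤ 12 * (a + 1) := by
        refine hval.trans (Nat.mul_le_mul_right _ (by omega))
      have hpow : 2 ^ 46 ≤ 2 ^ m := Nat.pow_le_pow_right (by norm_num) hm46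
      have e4 : 2 ^ (m + 2) = 4 * 2 ^ m := by ring
      rw [e4] at hab
      generalize 2 ^ m = Q at *
      norm_num at hpow
      nlinarith

lemma k_eq_three (D m a : ℕ) (hm : 3 ≤ m) (ha : Odd a) (hab : a ^ 2 + D = 2 ^ (m + 2))
    (hU : lucU a (2 ^ m) 3 = 1 ∨ lucU a (2 ^ m) 3 = -1) : D = 23 := by
  obtain ⟨ha1, hval⟩ := lucU_odd_bound a m 0 ha hm hU
  have e : lucU a (2 ^ m) 3 = (a : ℤ) ^ 2 - 2 ^ m := by
    simp [lucU]; ring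
  rw [e] at hU
  have e4 : 2 ^ (m + 2) = 4 * 2 ^ m := by ring
  rw [e4] at hab
  obtain ⟨s, hs⟩ := ha
  obtain ⟨i, rfl⟩ : ∃ i, m = i + 3 := ⟨m - 3, by omega⟩
  have e8 : 2 ^ (i + 3) = 8 * 2 ^ i := by ring
  rcases hU with h | h
  · have h' : a ^ 2 = 2 ^ (i + 3) + 1 := by zify; linarith
    have ha3 : a ≤ 3 := by nlinarith
    have ha3' : a = 3 := by omega
    subst ha3'
    omega
  · exfalso
    have h' : a ^ 2 + 1 = 2 ^ (i + 3) := by zify; linarith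
    have : a ^ 2 = 4 * (s * s + s) + 1 := by rw [hs]; ring
    omega

lemma forward (D z1 n1 z2 n2 : ℕ) (hDo : Odd D) (h7 : D ≠ 7) (hn1 : 0 < n1) (hn2 : 0 < n2)
    (h1 : z1 ^ 2 + D = 2 ^ n1) (h2 : z2 ^ 2 + D = 2 ^ n2) (hne : (z1, n1) ≠ (z2, n2)) :
    D = 23 ∨ ∃ k : ℕ, 3 < k ∧ D = 2 ^ k - 1 := by
  have hnn : n1 ≠ n2 := by
    rintro rfl
    apply hne
    have : z1 ^ 2 = z2 ^ 2 := by omega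
    have := Nat.pow_left_injective (n := 2) (by norm_num) this
    rw [this]
  have hsmall : 4 < D := by
    by_contra hc
    have hD13 : D = 1 ∨ D = 3 := by
      obtain ⟨s, hs⟩ := hDo; omega
    have hle : ∀ z n : ℕ, 0 < n → z ^ 2 + D = 2 ^ n → n = if D = 1 then 1 else 2 := by
      intro z n hn h
      obtain ⟨s, hs⟩ := sol_odd D z n hDo hn h
      obtain ⟨q, hq⟩ : ∃ q, z ^ 2 = 8 * q + 1 := by
        obtain ⟨q, hq⟩ := Nat.even_mul_succ_self s
        refine ⟨q, ?_⟩
        have : z ^ 2 = 4 * (s * (s + 1)) + 1 := by rw [hs]; ring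
        rw [this, hq]; ring
      rcases n with _ | _ | _ | n
      · omega
      · norm_num at h
        have : D = 1 := by omega
        simp [this]
      · norm_num at h
        have : D = 3 := by omega
        simp [this]
      · exfalso
        have : 2 ^ (n + 1 + 1 + 1) = 8 * 2 ^ n := by ring
        omega
    exact hnn ((hle z1 n1 hn1 h1).trans (hle z2 n2 hn2 h2).symm)
  obtain ⟨m, a, hm, ha, hab, hall⟩ := sol_struct D hsmall hDo z1 n1 h1
  -- one of the two solutions has k ≥ 2
  obtain ⟨z, n, k, hk, h, hn, hU⟩ : ∃ z n k : ℕ, 2 ≤ k ∧ z ^ 2 + D = 2 ^ n ∧ n = m * k + 2 ∧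
      (lucU a (2 ^ m) k = 1 ∨ lucU a (2 ^ m) k = -1) := by
    obtain ⟨k1, hk1, e1, u1⟩ := hall z1 n1 h1
    obtain ⟨k2, hk2, e2, u2⟩ := hall z2 n2 h2
    rcases Nat.lt_or_ge k1 2 with h | h
    · have hk2' : 2 ≤ k2 := by
        by_contra hc
        apply hnn
        have : k1 = k2 := by omega
        rw [e1, e2, this]
      exact ⟨z2, n2, k2, hk2', h2, e2, u2⟩
    · exact ⟨z1, n1, k1, h, h1, e1, u1⟩
  have hone : a = 1 → D = 23 ∨ ∃ k : ℕ, 3 < k ∧ D = 2 ^ k - 1 := by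
    rintro rfl
    right
    refine ⟨m + 2, ?_, by omega⟩
    by_contra hc
    have : m = 1 := by omega
    subst this
    norm_num at hab
    omega
  rcases Nat.even_or_odd k with ⟨l, hl⟩ | ⟨l, hl⟩
  · apply hone
    have hd := lucU_even_dvd (a : ℤ) (2 ^ m) l
    rw [two_mul, ← hl] at hd
    have : IsUnit (a : ℤ) := by
      rcases hU with h | h <;> rw [h] at hd
      · exact isUnit_of_dvd_one hd
      · exact isUnit_of_dvd_one ((dvd_neg.mp hd))
    rcases Int.isUnit_iff.mp this with h | h <;> omega
  · rcases Nat.lt_or_ge m 3 with hm3 | hm3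
    · have ha4 : a < 4 := by
        by_contra hc
        push Not at hc
        have : 2 ^ (m + 2) ≤ 2 ^ 4 := Nat.pow_le_pow_right (by norm_num) (by omega)
        nlinarith
      have : a = 1 ∨ a = 3 := by
        obtain ⟨s, hs⟩ := ha; omega
      rcases this with h1 | h3
      · exact hone h1
      · exfalso
        subst h3
        have : m = 1 ∨ m = 2 := by omega
        clear hone
        rcases this with rfl | rfl <;> norm_num at hab <;> omega
    · rcases Nat.lt_or_ge k 5 with hk5 | hk5
      · have : k = 3 := by omega
        subst this
        left
        exact k_eq_three D m a hm3 ha hab hU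
      · exfalso
        obtain ⟨j, rfl⟩ : ∃ j, k = 2 * j + 5 := ⟨l - 2, by omega⟩
        rw [hn] at h
        exact no_large_odd D m a z j (by omega) hm3 ha hab
          (sol_odd D z _ hDo (by omega) h) h hU

lemma set_23 : {p : ℕ × ℕ | 0 < p.1 ∧ 0 < p.2 ∧ p.1 ^ 2 + 23 = 2 ^ p.2} = {(3, 5), (45, 11)} := by
  ext ⟨z, n⟩
  simp only [Set.mem_setOf_eq, Set.mem_insert_iff, Set.mem_singleton_iff, Prod.mk.injEq]
  constructor
  · rintro ⟨-, hn0, h⟩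
    have hDo : Odd 23 := by decide
    obtain ⟨m, a, hm, ha, hab, hall⟩ := sol_struct 23 (by norm_num) hDo 3 5 (by norm_num)
    obtain ⟨k0, hk0, e0, -⟩ := hall 3 5 (by norm_num)
    have hm3 : m = 3 := by
      have hd : m ∣ 3 := ⟨k0, by omega⟩
      rcases (Nat.dvd_prime Nat.prime_three).mp hd with h | h
      · exfalso
        subst h
        norm_num at hab
        omega
      · exact h
    subst hm3
    have ha3 : a = 3 := by
      norm_num at hab
      have : a ^ 2 = 3 ^ 2 := by omega
      exact Nat.pow_left_injective (n := 2) (by norm_num) this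
    subst ha3
    obtain ⟨k, hk, hn, hU⟩ := hall z n h
    have hzz : ∀ y : ℕ, z ^ 2 = y ^ 2 → z = y := fun y hy =>
      Nat.pow_left_injective (n := 2) (by norm_num) hy
    rcases Nat.even_or_odd k with ⟨l, hl⟩ | ⟨l, hl⟩
    · exfalso
      have hd := lucU_even_dvd ((3 : ℕ) : ℤ) (2 ^ 3) l
      rw [two_mul, ← hl] at hd
      rcases hU with h | h <;> rw [h] at hd <;> norm_num at hd
    · rcases Nat.lt_or_ge k 5 with hk5 | hk5
      · have : k = 1 ∨ k = 3 := by omega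
        rcases this with rfl | rfl
        · left
          norm_num at hn
          subst hn
          norm_num at h
          exact ⟨hzz 3 (by omega), rfl⟩
        · right
          norm_num at hn
          subst hn
          norm_num at h
          exact ⟨hzz 45 (by omega), rfl⟩
      · exfalso
        obtain ⟨j, rfl⟩ : ∃ j, k = 2 * j + 5 := ⟨l - 2, by omega⟩
        rw [hn] at h
        exact no_large_odd 23 3 3 z j (by omega) le_rfl ha hab
          (sol_odd 23 z _ hDo (by omega) h) h hU
  · rintro (⟨rfl, rfl⟩ | ⟨rfl, rfl⟩) <;> norm_num

lemma set_pow (D K : ℕ) (hK : 3 < K) (hD : D = 2 ^ K - 1) :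
    {p : ℕ × ℕ | 0 < p.1 ∧ 0 < p.2 ∧ p.1 ^ 2 + D = 2 ^ p.2} =
      {(1, K), (2 ^ (K - 1) - 1, 2 * K - 2)} := by
  have h16 : 2 ^ 4 ≤ 2 ^ K := Nat.pow_le_pow_right (by norm_num) hK
  have hD1 : D + 1 = 2 ^ K := by omega
  have hDo : Odd D := by
    have : Even (D + 1) := by rw [hD1]; exact even_two.pow_of_ne_zero (by omega)
    rcases Nat.even_or_odd D with h | h
    · exact absurd this (by simpa using h.add_one)
    · exact h
  have hsq : (2 ^ (K - 1) - 1) ^ 2 + D = 2 ^ (2 * K - 2) := by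
    obtain ⟨i, rfl⟩ : ∃ i, K = i + 1 := ⟨K - 1, by omega⟩
    have e1 : i + 1 - 1 = i := by omega
    have e2 : 2 * (i + 1) - 2 = i + i := by omega
    have e3 : 2 ^ (i + 1) = 2 * 2 ^ i := by ring
    rw [e1, e2, pow_add]
    rw [e3] at hD1
    have : 1 ≤ 2 ^ i := Nat.one_le_two_pow
    obtain ⟨y, hy⟩ : ∃ y, 2 ^ i = y + 1 := ⟨2 ^ i - 1, by omega⟩
    rw [hy] at hD1 ⊢
    rw [Nat.add_sub_cancel]
    nlinarith
  ext ⟨z, n⟩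
  simp only [Set.mem_setOf_eq, Set.mem_insert_iff, Set.mem_singleton_iff, Prod.mk.injEq]
  constructor
  · rintro ⟨-, hn0, h⟩
    obtain ⟨m, a, hm, ha, hab, hall⟩ := sol_struct D (by omega) hDo 1 K (by omega)
    obtain ⟨k0, hk0, e0, -⟩ := hall 1 K (by omega)
    have hapos : 1 ≤ a ^ 2 := by
      obtain ⟨s, hs⟩ := ha
      exact Nat.one_le_pow _ _ (by omega)
    have hmK : K ≤ m + 2 := by
      have : 2 ^ K ≤ 2 ^ (m + 2) := by omega
      exact (Nat.pow_le_pow_iff_right (by norm_num : 1 < 2)).mp this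
    have hmk0 : m * 1 ≤ m * k0 := Nat.mul_le_mul_left m hk0
    have hKm : K = m + 2 := by omega
    subst hKm
    have ha1 : a = 1 := by
      have : a ^ 2 = 1 ^ 2 := by omega
      exact Nat.pow_left_injective (n := 2) (by norm_num) this
    subst ha1
    obtain ⟨k, hk, hn, hU⟩ := hall z n h
    have hzz : ∀ y : ℕ, z ^ 2 = y ^ 2 → z = y := fun y hy =>
      Nat.pow_left_injective (n := 2) (by norm_num) hy
    rcases Nat.lt_or_ge k 3 with hk3 | hk3
    · have : k = 1 ∨ k = 2 := by omega
      rcases this with rfl | rfl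
      · left
        rw [mul_one] at hn
        subst hn
        exact ⟨hzz 1 (by omega), rfl⟩
      · right
        have hn' : n = 2 * (m + 2) - 2 := by omega
        subst hn'
        exact ⟨hzz _ (by omega), rfl⟩
    · exfalso
      rcases Nat.even_or_odd k with ⟨l, hl⟩ | ⟨l, hl⟩
      · have e : n = 2 * (m * l + 1) := by rw [hn, hl]; ring
        rw [e] at h
        have h1 := even_exp_bound z D _ (by omega) h
        have hml : m * 2 ≤ m * l := Nat.mul_le_mul_left m (by omega)
        have h2 : 2 ^ (m + 2) ≤ 2 ^ (m * l + 1) :=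
          Nat.pow_le_pow_right (by norm_num) (by omega)
        omega
      · obtain ⟨j, rfl⟩ : ∃ j, k = 2 * j + 3 := ⟨l - 1, by omega⟩
        exact lucU_one_odd m j (by omega) (by exact_mod_cast hU)
  · have hK1 : 2 ^ 1 ≤ 2 ^ (K - 1) := Nat.pow_le_pow_right (by norm_num) (by omega)
    rintro (⟨rfl, rfl⟩ | ⟨rfl, rfl⟩)
    · exact ⟨by norm_num, by omega, by omega⟩
    · exact ⟨by omega, by omega, hsq⟩

/-- Beukers' classification: for odd positive `D`, the equation `z² + D = 2ⁿ` has
exactly two solutions in positive integers iff `D = 23` or `D = 2^k − 1` with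
`k > 3`; in the latter case the solutions are `(1, k)` and `(2^{k−1} − 1, 2k − 2)`. -/
theorem beukers_two_solutions
    (D : ℕ) (hpos : 0 < D) (hodd : Odd D) :
    ({p : ℕ × ℕ | 0 < p.1 ∧ 0 < p.2 ∧ p.1 ^ 2 + D = 2 ^ p.2}.encard = 2 ↔
      D = 23 ∨ ∃ k : ℕ, 3 < k ∧ D = 2 ^ k - 1) ∧
    (∀ k : ℕ, 3 < k → D = 2 ^ k - 1 →
      {p : ℕ × ℕ | 0 < p.1 ∧ 0 < p.2 ∧ p.1 ^ 2 + D = 2 ^ p.2} =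
        {(1, k), (2 ^ (k - 1) - 1, 2 * k - 2)}) := by
  refine ⟨⟨?_, ?_⟩, fun k hk hD => set_pow D k hk hD⟩
  · intro hcard
    obtain ⟨⟨z1, n1⟩, ⟨z2, n2⟩, hne, hS⟩ := Set.encard_eq_two.mp hcard
    have hm1 : ((z1, n1) : ℕ × ℕ) ∈
        {p : ℕ × ℕ | 0 < p.1 ∧ 0 < p.2 ∧ p.1 ^ 2 + D = 2 ^ p.2} := by rw [hS]; simp
    have hm2 : ((z2, n2) : ℕ × ℕ) ∈
        {p : ℕ × ℕ | 0 < p.1 ∧ 0 < p.2 ∧ p.1 ^ 2 + D = 2 ^ p.2} := by rw [hS]; simp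
    have h7 : D ≠ 7 := by
      rintro rfl
      have a1 : ((1, 3) : ℕ × ℕ) ∈ ({(z1, n1), (z2, n2)} : Set (ℕ × ℕ)) := by
        rw [← hS]; norm_num
      have a2 : ((3, 4) : ℕ × ℕ) ∈ ({(z1, n1), (z2, n2)} : Set (ℕ × ℕ)) := by
        rw [← hS]; norm_num
      have a3 : ((5, 5) : ℕ × ℕ) ∈ ({(z1, n1), (z2, n2)} : Set (ℕ × ℕ)) := by
        rw [← hS]; norm_num
      simp only [Set.mem_insert_iff, Set.mem_singleton_iff, Prod.mk.injEq] at a1 a2 a3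
      omega
    exact forward D z1 n1 z2 n2 hodd h7 hm1.2.1 hm2.2.1 hm1.2.2 hm2.2.2 hne
  · rintro (rfl | ⟨k, hk, hD⟩)
    · rw [set_23]
      exact Set.encard_pair (by decide)
    · rw [set_pow D k hk hD]
      apply Set.encard_pair
      intro h
      have := (Prod.mk.injEq _ _ _ _ ▸ h).2
      omega
end

section
/- The set of pairs (z, n) of nonnegative integers satisfying z² + 119 = 15·2ⁿ is exactly {(1, 3), (11, 4), (19, 5), (29, 6), (61, 8), (701, 15)}. In particular this equation of Ramanujan–Nagell type has exactly six solutions. -/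
/-- The second-order recurrence attached to `α² = 3α - 32`, normalised by `Y 0 = 1`, `Y 1 = c`. -/
def stY (c : ℤ) : ℕ → ℤ
  | 0 => 1
  | 1 => c
  | n + 2 => 3 * stY c (n + 1) - 32 * stY c n

/-- The order `ℤ[α]`, `α² = -32 + 3α`. -/
abbrev StR := QuadraticAlgebra ℤ (-32) 3

/-- The element `α`. -/
def stA : StR := ⟨0, 1⟩

lemma stA_sq : stA ^ 2 = 3 * stA - 32 := by
  ext <;> simp [pow_two, stA, QuadraticAlgebra.re_ofNat, QuadraticAlgebra.im_ofNat]

/-- `Y` as a coordinate of a power of `α`. -/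
lemma stY_pow (c : ℤ) (n : ℕ) :
    (⟨c - 3, 1⟩ * stA ^ n : StR) = ⟨stY c (n + 1) - 3 * stY c n, stY c n⟩ := by
  induction n with
  | zero => ext <;> simp [stY]
  | succ n ih =>
    rw [pow_succ, ← mul_assoc, ih]
    ext
    · simp [stA, stY]
    · simp [stA]

lemma stA_lift (s : ℕ) : ∃ e : StR,
    stA ^ (4 * 5 ^ s) = 1 + 5 * 5 ^ s * (2 + 2 * stA + 5 * e) := by
  induction s with
  | zero =>
    refine ⟨29 - 7 * stA, ?_⟩
    have h : stA ^ (4 * 5 ^ 0) = (stA ^ 2) ^ 2 := by ring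
    rw [h, stA_sq]
    linear_combination 9 * stA_sq
  | succ s ih =>
    obtain ⟨e, he⟩ := ih
    set P : StR := 5 ^ s with hP
    set b : StR := 2 + 2 * stA + 5 * e with hb
    refine ⟨e + 2 * P * b ^ 2 + 10 * P ^ 2 * b ^ 3 + 25 * P ^ 3 * b ^ 4 + 25 * P ^ 4 * b ^ 5, ?_⟩
    have h : stA ^ (4 * 5 ^ (s + 1)) = (stA ^ (4 * 5 ^ s)) ^ 5 := by
      rw [← pow_mul]; ring_nf
    rw [h, he, pow_succ 5 s, ← hP]
    linear_combination (-25 * P) * hb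

lemma st_binom (x : StR) (j : ℕ) : ∃ e : StR, (1 + x) ^ j = 1 + (j : StR) * x + x ^ 2 * e := by
  induction j with
  | zero => exact ⟨0, by simp⟩
  | succ j ih =>
    obtain ⟨e, he⟩ := ih
    refine ⟨e + j + x * e, ?_⟩
    rw [pow_succ, he]
    push_cast
    ring

lemma st_im_C (n : ℤ) (x : StR) : (QuadraticAlgebra.C n * x).im = n * x.im := by
  simp

lemma st_im_nat (n : ℕ) (x : StR) : ((n : StR) * x).im = n * x.im := by
  simp

/-- The `5`-adic argument. -/
lemma st_skolem (a : ℤ) (ha : a % 5 = 3) (k : ℕ)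
    (h : ((⟨a, 1⟩ : StR) * stA ^ (4 * k)).im = 1) : k = 0 := by
  have key : ∀ s : ℕ, 5 ^ s ∣ k := by
    intro s
    induction s with
    | zero => simp
    | succ s ih =>
      obtain ⟨j, rfl⟩ := ih
      obtain ⟨e, he⟩ := stA_lift s
      obtain ⟨f, hf⟩ := st_binom (5 * 5 ^ s * (2 + 2 * stA + 5 * e)) j
      rw [← mul_assoc, pow_mul, he, hf] at h
      set b : StR := 2 + 2 * stA + 5 * e with hb
      have h2 : ((⟨a, 1⟩ : StR) * (1 + (j : StR) * (5 * 5 ^ s * b) + (5 * 5 ^ s * b) ^ 2 * f))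
          = ⟨a, 1⟩ + QuadraticAlgebra.C (5 * 5 ^ s : ℤ) * ((j : StR) * (⟨a, 1⟩ * b)
            + QuadraticAlgebra.C (5 * 5 ^ s : ℤ) * (⟨a, 1⟩ * b ^ 2 * f)) := by
        have : (QuadraticAlgebra.C (5 * 5 ^ s : ℤ) : StR) = 5 * 5 ^ s := by
          rw [QuadraticAlgebra.C_mul, QuadraticAlgebra.C_pow]; rfl
        rw [this]; ring
      rw [h2] at h
      set g : StR := ⟨a, 1⟩ * b ^ 2 * f with hg
      have hbim : ((⟨a, 1⟩ : StR) * b).im = 2 * a + 8 + 5 * (a * e.im + e.re + 3 * e.im) := by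
        simp [hb, stA, QuadraticAlgebra.re_ofNat, QuadraticAlgebra.im_ofNat]; ring
      have h3 : (5 * 5 ^ s : ℤ) * ((j : ℤ) * ((⟨a, 1⟩ : StR) * b).im + 5 * 5 ^ s * g.im) = 0 := by
        rw [QuadraticAlgebra.im_add, st_im_C, QuadraticAlgebra.im_add, st_im_C, st_im_nat] at h
        simpa only [add_eq_left] using h
      have h4 := (mul_eq_zero.mp h3).resolve_left (by positivity)
      rw [hbim] at h4
      have h5 : (5 : ℤ) ∣ (j : ℤ) * (2 * a + 8) := by
        refine ⟨-(j * (a * e.im + e.re + 3 * e.im) + 5 ^ s * g.im), ?_⟩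
        linear_combination h4
      have h6 : (5 : ℤ) ∣ (j : ℤ) := by
        rcases (Int.prime_iff_natAbs_prime.mpr (by norm_num) : Prime (5 : ℤ)).dvd_or_dvd h5 with h | h
        · exact h
        · omega
      have h7 : 5 ∣ j := by exact_mod_cast h6
      rw [pow_succ]
      exact mul_dvd_mul_left _ h7
  by_contra hk
  have := Nat.le_of_dvd (Nat.pos_of_ne_zero hk) (key k)
  exact absurd this (not_le.mpr (Nat.lt_pow_self (by norm_num)))

/-- `Y` along progressions of difference `4`. -/
lemma stY_skolem (c : ℤ) (m k : ℕ) (hm : stY c m = 1)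
    (ha : (stY c (m + 1) - 3) % 5 = 3) (h : stY c (m + 4 * k) = 1) : k = 0 := by
  apply st_skolem (stY c (m + 1) - 3) ha k
  have h1 := stY_pow c (m + 4 * k)
  rw [pow_add, ← mul_assoc, stY_pow c m, hm] at h1
  have h2 := congrArg QuadraticAlgebra.im h1
  rw [h] at h2
  simpa using h2

lemma stY_even (c : ℤ) (hc : c % 2 = 1) (m : ℕ) : (stY c (m + 1) - 3 * stY c m) % 2 = 0 := by
  cases m with
  | zero => simp [stY]; omega
  | succ m => simp only [stY]; omega

/-- The pairs reached by the descent. -/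
def StGood (x y : ℤ) (k : ℕ) : Prop :=
  ∃ (r : ℕ) (c : ℤ) (m : ℕ) (e : ℤ),
    ((r = 1 ∧ c = 1) ∨ (r = 2 ∧ c = 7) ∨ (r = 3 ∧ c = 11) ∨ (r = 4 ∧ c = -13)) ∧
    (e = 1 ∨ e = -1) ∧ k = r + 5 * m ∧ y = e * stY c m ∧
    (x = e * (2 * stY c (m + 1) - 3 * stY c m) ∨ x = -(e * (2 * stY c (m + 1) - 3 * stY c m)))

lemma StGood.neg {x y : ℤ} {k : ℕ} (h : StGood x y k) : StGood (-x) y k := by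
  obtain ⟨r, c, m, e, hr, he, hk, hy, hx⟩ := h
  refine ⟨r, c, m, e, hr, he, hk, hy, ?_⟩
  rcases hx with hx | hx
  · right; rw [hx]
  · left; rw [hx]; ring

lemma st_base (r : ℕ) (c x y : ℤ)
    (hr : (r = 1 ∧ c = 1) ∨ (r = 2 ∧ c = 7) ∨ (r = 3 ∧ c = 11) ∨ (r = 4 ∧ c = -13))
    (hy : y = 1 ∨ y = -1) (hx : x ^ 2 = (2 * c - 3) ^ 2) : StGood x y r := by
  refine ⟨r, c, 0, y, hr, hy, by simp, by simp [stY], ?_⟩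
  simp only [stY]
  rcases sq_eq_sq_iff_eq_or_eq_neg.mp hx with h | h <;> rcases hy with h' | h' <;> subst h h' <;>
    norm_num

lemma st_split (x y : ℤ) (hx : x % 2 = 1) (hy : y % 2 = 1) (h : (128 : ℤ) ∣ (x - 3 * y) * (x + 3 * y)) :
    (64 : ℤ) ∣ x - 3 * y ∨ (64 : ℤ) ∣ x + 3 * y := by
  have h4 : (x - 3 * y) % 4 = 2 ∨ (x + 3 * y) % 4 = 2 := by omega
  have cop : ∀ u : ℤ, u % 2 = 1 → IsCoprime (64 : ℤ) u := by
    intro u hu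
    have : IsCoprime (2 : ℤ) u := by
      refine ⟨-(u / 2), 1, by omega⟩
    have h := this.pow_left (m := 6)
    norm_num at h
    exact h
  rcases h4 with h4 | h4
  · right
    obtain ⟨u, hu⟩ : ∃ u, x - 3 * y = 2 * u := ⟨(x - 3 * y) / 2, by omega⟩
    rw [hu] at h
    have : (64 : ℤ) ∣ u * (x + 3 * y) := by
      obtain ⟨w, hw⟩ := h
      exact ⟨w, by linarith⟩
    exact (cop u (by omega)).dvd_of_dvd_mul_left this
  · left
    obtain ⟨u, hu⟩ : ∃ u, x + 3 * y = 2 * u := ⟨(x + 3 * y) / 2, by omega⟩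
    rw [hu] at h
    have : (64 : ℤ) ∣ u * (x - 3 * y) := by
      obtain ⟨w, hw⟩ := h
      exact ⟨w, by linarith⟩
    exact (cop u (by omega)).dvd_of_dvd_mul_left this

lemma st_step (k : ℕ)
    (ih : ∀ x y : ℤ, x % 2 = 1 → y % 2 = 1 → x ^ 2 + 119 * y ^ 2 = 60 * 2 ^ k → StGood x y k)
    (x y : ℤ) (hx : x % 2 = 1) (hy : y % 2 = 1) (h : x ^ 2 + 119 * y ^ 2 = 60 * 2 ^ (k + 5))
    (hd : (64 : ℤ) ∣ x - 3 * y) : StGood x y (k + 5) := by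
  obtain ⟨t, ht⟩ := hd
  have hx' : x = 3 * y + 64 * t := by linarith
  subst hx'
  have h1 : y ^ 2 + 3 * (y * t) + 32 * t ^ 2 = 15 * 2 ^ k := by
    rw [pow_add] at h; linarith
  have h2 : (2 * y + 3 * t) ^ 2 + 119 * t ^ 2 = 60 * 2 ^ k := by linarith
  rcases Int.emod_two_eq_zero_or_one t with ht2 | ht2
  · exfalso
    obtain ⟨s, rfl⟩ : ∃ s, t = 2 * s := ⟨t / 2, by omega⟩
    obtain ⟨v, rfl⟩ : ∃ v, y = 2 * v + 1 := ⟨y / 2, by omega⟩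
    rcases k with _ | k
    · have hs : s = 0 := by
        by_contra hs
        have : 0 < s ^ 2 := by positivity
        nlinarith [sq_nonneg (2 * (2 * v + 1) + 3 * (2 * s))]
      subst hs
      have hv1 : v < 2 := by nlinarith
      have hv2 : -3 < v := by nlinarith
      interval_cases v <;> norm_num at h1
    · rw [pow_succ] at h1
      ring_nf at h1
      omega
  · obtain ⟨r, c, m, e, hr, he, hk, hy', hx'⟩ := ih _ _ (by omega) ht2 h2
    have hc : c % 2 = 1 := by omega
    have hev := stY_even c hc m
    refine ⟨r, c, m + 1, -e, hr, by omega, by omega, ?_, ?_⟩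
    · rcases hx' with hx' | hx'
      · exfalso
        have : y = e * (stY c (m + 1) - 3 * stY c m) := by linarith
        rcases he with rfl | rfl <;> omega
      · linarith
    · rcases hx' with hx' | hx'
      · exfalso
        have : y = e * (stY c (m + 1) - 3 * stY c m) := by linarith
        rcases he with rfl | rfl <;> omega
      · left
        simp only [stY]
        linarith

lemma st_descent (k : ℕ) : ∀ x y : ℤ, x % 2 = 1 → y % 2 = 1 →
    x ^ 2 + 119 * y ^ 2 = 60 * 2 ^ k → StGood x y k := by
  induction k using Nat.strong_induction_on with
  | _ k ih =>
  intro x y hx hy h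
  by_cases hk : k < 5
  · have hk2 : (2 : ℤ) ^ k ≤ 2 ^ 4 := pow_le_pow_right₀ (by norm_num) (by omega)
    have hy1 : y < 3 := by nlinarith [sq_nonneg x]
    have hy2 : -3 < y := by nlinarith [sq_nonneg x]
    have hy3 : y = 1 ∨ y = -1 := by omega
    have hy4 : y ^ 2 = 1 := by rcases hy3 with rfl | rfl <;> norm_num
    rw [hy4] at h
    interval_cases k
    · nlinarith [sq_nonneg x]
    · exact st_base 1 1 x y (by simp) hy3 (by linarith)
    · exact st_base 2 7 x y (by simp) hy3 (by linarith)
    · exact st_base 3 11 x y (by simp) hy3 (by linarith)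
    · exact st_base 4 (-13) x y (by simp) hy3 (by linarith)
  · obtain ⟨l, rfl⟩ : ∃ l, k = l + 5 := ⟨k - 5, by omega⟩
    have ihl := ih l (by omega)
    have hdiv : (128 : ℤ) ∣ (x - 3 * y) * (x + 3 * y) := by
      refine ⟨15 * 2 ^ l - y ^ 2, ?_⟩
      rw [pow_add] at h
      linarith
    rcases st_split x y hx hy hdiv with hd | hd
    · exact st_step l ihl x y hx hy h hd
    · have := st_step l ihl (-x) y (by omega) hy (by linarith)
        (by obtain ⟨w, hw⟩ := hd; exact ⟨-w, by linarith⟩)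
      simpa using this.neg

/-- Periodicity of `Y` modulo `32` and modulo `11`. -/
lemma stY_mod (c : ℤ) (j i : ℕ) :
    stY c (i + 1 + 8 * j) % 32 = stY c (i + 1) % 32 ∧ stY c (i + 8 * j) % 11 = stY c i % 11 ∧
      stY c (i + 8 * j) % 5 = stY c i % 5 := by
  have h8 : ∀ n, stY c (n + 9) % 32 = stY c (n + 1) % 32 ∧ stY c (n + 8) % 11 = stY c n % 11 ∧
      stY c (n + 8) % 5 = stY c n % 5 := by
    intro n
    simp only [stY]
    omega
  induction j with
  | zero => simp
  | succ j ih =>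
    have a := (h8 (i + 8 * j)).1
    have b := (h8 (i + 8 * j)).2
    rw [show i + 1 + 8 * (j + 1) = i + 8 * j + 9 by ring,
      show i + 8 * (j + 1) = i + 8 * j + 8 by ring]
    rw [show i + 1 + 8 * j = i + 8 * j + 1 by ring] at ih
    exact ⟨a.trans ih.1, b.1.trans ih.2.1, b.2.trans ih.2.2⟩

set_option maxHeartbeats 4000000 in
lemma st_index (r : ℕ) (c : ℤ) (m : ℕ)
    (hr : (r = 1 ∧ c = 1) ∨ (r = 2 ∧ c = 7) ∨ (r = 3 ∧ c = 11) ∨ (r = 4 ∧ c = -13))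
    (h : stY c m = 1 ∨ stY c m = -1) :
    m = 0 ∨ (r = 1 ∧ m = 1) ∨ (r = 3 ∧ m = 2) := by
  rcases Nat.eq_zero_or_pos m with h0 | h0
  · exact Or.inl h0
  obtain ⟨j, i, hi, rfl⟩ : ∃ j i, i < 8 ∧ m = i + 1 + 8 * j :=
    ⟨(m - 1) / 8, (m - 1) % 8, Nat.mod_lt _ (by norm_num), by omega⟩
  have h1 := (stY_mod c j i).1
  have h2 := (stY_mod c j (i + 1)).2
  generalize hv : stY c (i + 1 + 8 * j) = v at h h1 h2
  rcases hr with ⟨rfl, rfl⟩ | ⟨rfl, rfl⟩ | ⟨rfl, rfl⟩ | ⟨rfl, rfl⟩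
  · have hi0 : i = 0 := by
      interval_cases i <;> simp only [stY] at h1 h2 <;> omega
    subst hi0
    have h3 : stY 1 (1 + 4 * (2 * j)) = 1 := by
      rw [show 1 + 4 * (2 * j) = 0 + 1 + 8 * j by ring, hv]
      norm_num [stY] at h1 h2
      omega
    have := stY_skolem 1 1 (2 * j) (by norm_num [stY]) (by norm_num [stY]) h3
    omega
  · exfalso
    interval_cases i <;> simp only [stY] at h1 h2 <;> omega
  · have hi0 : i = 1 := by
      interval_cases i <;> simp only [stY] at h1 h2 <;> omega
    subst hi0
    have h3 : stY 11 (2 + 4 * (2 * j)) = 1 := by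
      rw [show 2 + 4 * (2 * j) = 1 + 1 + 8 * j by ring, hv]
      norm_num [stY] at h1 h2
      omega
    have := stY_skolem 11 2 (2 * j) (by norm_num [stY]) (by norm_num [stY]) h3
    omega
  · exfalso
    interval_cases i <;> simp only [stY] at h1 h2 <;> omega

lemma st_exponent (z n : ℕ) (h : z ^ 2 + 119 = 15 * 2 ^ n) :
    n = 3 ∨ n = 4 ∨ n = 5 ∨ n = 6 ∨ n = 8 ∨ n = 15 := by
  have hn : 3 ≤ n := by
    by_contra hn
    have : n < 3 := by omega
    interval_cases n <;> omega
  obtain ⟨k, rfl⟩ : ∃ k, n = k + 2 := ⟨n - 2, by omega⟩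
  have hz : (z : ℤ) ^ 2 + 119 * 1 ^ 2 = 60 * 2 ^ k := by
    have h' : (z : ℤ) ^ 2 + 119 = 15 * 2 ^ (k + 2) := by exact_mod_cast h
    rw [pow_add] at h'
    linarith
  have hodd : (z : ℤ) % 2 = 1 := by
    rcases Int.emod_two_eq_zero_or_one (z : ℤ) with h0 | h0
    · exfalso
      obtain ⟨w, hw⟩ : ∃ w, (z : ℤ) = 2 * w := ⟨(z : ℤ) / 2, by omega⟩
      rw [hw] at hz
      ring_nf at hz
      omega
    · exact h0
  obtain ⟨r, c, m, e, hr, he, hk, hy, -⟩ := st_descent k z 1 hodd (by norm_num) hz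
  have hY : stY c m = 1 ∨ stY c m = -1 := by
    rcases he with rfl | rfl <;> omega
  have := st_index r c m hr hY
  omega

theorem stiller_six_solutions :
    {p : ℕ × ℕ | p.1 ^ 2 + 119 = 15 * 2 ^ p.2} =
        {(1, 3), (11, 4), (19, 5), (29, 6), (61, 8), (701, 15)} ∧
      {p : ℕ × ℕ | p.1 ^ 2 + 119 = 15 * 2 ^ p.2}.encard = 6 := by
  have key : {p : ℕ × ℕ | p.1 ^ 2 + 119 = 15 * 2 ^ p.2} =
        {(1, 3), (11, 4), (19, 5), (29, 6), (61, 8), (701, 15)} := by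
    ext ⟨z, n⟩
    simp only [Set.mem_setOf_eq, Set.mem_insert_iff, Set.mem_singleton_iff, Prod.mk.injEq]
    constructor
    · intro h
      have sq : ∀ a : ℕ, z ^ 2 = a ^ 2 → z = a := fun a ha =>
        Nat.pow_left_injective (n := 2) (by norm_num) ha
      rcases st_exponent z n h with rfl | rfl | rfl | rfl | rfl | rfl
      · have := sq 1 (by omega); omega
      · have := sq 11 (by omega); omega
      · have := sq 19 (by omega); omega
      · have := sq 29 (by omega); omega
      · have := sq 61 (by omega); omega
      · have := sq 701 (by omega); omega
    · rintro (⟨rfl, rfl⟩ | ⟨rfl, rfl⟩ | ⟨rfl, rfl⟩ | ⟨rfl, rfl⟩ | ⟨rfl, rfl⟩ | ⟨rfl, rfl⟩) <;> norm_num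
  refine ⟨key, ?_⟩
  rw [key]
  have : ({(1, 3), (11, 4), (19, 5), (29, 6), (61, 8), (701, 15)} : Set (ℕ × ℕ)) =
      (({(1, 3), (11, 4), (19, 5), (29, 6), (61, 8), (701, 15)} : Finset (ℕ × ℕ)) : Set (ℕ × ℕ)) := by
    simp
  rw [this, Set.encard_coe_eq_coe_finsetCard]
  rfl
end
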